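/- Let p be a prime with 2² exactly dividing p−1 (i.e. p ≡ 5 (mod 8)), and set S = (Σ_{i=0}^{(p-3)/2} (−1)^i·v_{2i})² + (Σ_{i=0}^{(p-3)/2} (−1)^i·v_{2i+1})². Let L be the unique subfield of K = ℚ(ζ_p) with [L:ℚ] = 4 and let M be the unique subfield with [M:ℚ] = 2 (so M = ℚ(√p) and M ⊂ L). If h is an odd prime dividing the class number of L but not dividing the class number of M, then S ≠ 0 and S ≡ 0 (mod h). -/

import Mathlib

section PartA
open NumberField Finset

lemma vn_cast (p : ℕ) (v : ℕ) (vn : ℤ → ℕ) (hvn0 : vn 0 = 1)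
    (hvnrec : ∀ n : ℤ, (vn (n + 1) : ZMod p) = (v : ZMod p) * (vn n : ZMod p)) (n : ℕ) :
    (vn (n : ℤ) : ZMod p) = (v : ZMod p) ^ n := by
  induction n with
  | zero => simp [hvn0]
  | succ k ih => push_cast; rw [hvnrec, ih]; ring

lemma partA_odd (p : ℕ) (hp : p.Prime) (v : ℕ)
    (hv : orderOf (v : ZMod p) = p - 1)
    (vn : ℤ → ℕ)
    (hvn1 : ∀ n : ℤ, 1 ≤ vn n) (hvn2 : ∀ n : ℤ, vn n ≤ p - 1)
    (hvn : ∀ n : ℕ, (vn (n : ℤ) : ZMod p) = (v : ZMod p) ^ n)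
    (hp8 : p % 8 = 5) :
    ((∑ i ∈ Finset.range ((p - 1) / 2), (-1 : ℤ) ^ i * (vn ((2 * i : ℕ) : ℤ) : ℤ) : ℤ) : ZMod 2) = 1 := by
  haveI : Fact p.Prime := ⟨hp⟩
  obtain ⟨k, hk⟩ : ∃ k, p = 8 * k + 5 := ⟨p / 8, by omega⟩
  have hm : (p - 1) / 2 = (2 * k + 1) + (2 * k + 1) := by omega
  have hhalf : (v : ZMod p) ^ (2 * (2 * k + 1)) = -1 := by
    have h1 : ((v : ZMod p) ^ (2 * (2 * k + 1))) ^ 2 = 1 := by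
      rw [← pow_mul, show 2 * (2 * k + 1) * 2 = p - 1 by omega, ← hv, pow_orderOf_eq_one]
    rcases mul_self_eq_one_iff.mp ((sq _).symm.trans h1) with h | h
    · exfalso
      have := orderOf_dvd_of_pow_eq_one h
      rw [hv] at this
      have := Nat.le_of_dvd (by omega) this
      omega
    · exact h
  have hrefl : ∀ i : ℕ, (vn ((2 * (2 * k + 1 + i) : ℕ) : ℤ) : ℤ) = p - vn ((2 * i : ℕ) : ℤ) := by
    intro i
    have h1 : ((vn ((2 * (2 * k + 1 + i) : ℕ) : ℤ) + vn ((2 * i : ℕ) : ℤ) : ℕ) : ZMod p) = 0 := by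
      rw [Nat.cast_add, hvn, hvn, mul_add, pow_add, hhalf]; ring
    rw [ZMod.natCast_eq_zero_iff] at h1
    have a1 := hvn1 ((2 * (2 * k + 1 + i) : ℕ) : ℤ)
    have a2 := hvn2 ((2 * (2 * k + 1 + i) : ℕ) : ℤ)
    have b1 := hvn1 ((2 * i : ℕ) : ℤ)
    have b2 := hvn2 ((2 * i : ℕ) : ℤ)
    generalize vn ((2 * (2 * k + 1 + i) : ℕ) : ℤ) = x at *
    generalize vn ((2 * i : ℕ) : ℤ) = y at *
    obtain ⟨c, hc⟩ := h1
    have : c = 1 := by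
      have h0 : c ≠ 0 := by rintro rfl; omega
      have h2 : c < 2 := by
        by_contra h
        have : p * 2 ≤ p * c := Nat.mul_le_mul_left _ (by omega)
        omega
      omega
    subst this
    omega
  rw [hm, Finset.sum_range_add]
  have : ∀ i : ℕ, (-1 : ℤ) ^ (2 * k + 1 + i) * (vn ((2 * (2 * k + 1 + i) : ℕ) : ℤ) : ℤ)
      = - ((-1 : ℤ) ^ i * (p - vn ((2 * i : ℕ) : ℤ))) := by
    intro i
    rw [hrefl, pow_add, pow_add, pow_mul]; norm_num
  simp_rw [this]
  rw [← Finset.sum_add_distrib]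
  have h2 : ∀ i : ℕ, ((((-1 : ℤ) ^ i * (vn ((2 * i : ℕ) : ℤ) : ℤ) +
      - ((-1 : ℤ) ^ i * (p - vn ((2 * i : ℕ) : ℤ))) : ℤ)) : ZMod 2) = 1 := by
    intro i
    have : (-1 : ℤ) ^ i * (vn ((2 * i : ℕ) : ℤ) : ℤ) +
      - ((-1 : ℤ) ^ i * (p - vn ((2 * i : ℕ) : ℤ))) = (-1)^i * (2 * vn ((2 * i : ℕ) : ℤ) - p) := by ring
    rw [this, hk]
    push_cast
    have h20 : (2 : ZMod 2) = 0 := rfl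
    have h80 : (8 : ZMod 2) = 0 := rfl
    have h51 : (5 : ZMod 2) = 1 := rfl
    have hm1 : (-1 : ZMod 2) = 1 := rfl
    rw [h20, h80, h51, hm1]; simp [hm1]
  rw [Int.cast_sum, Finset.sum_congr rfl fun i _ => h2 i]
  have h20 : (2 : ZMod 2) = 0 := rfl
  simp [h20]

lemma partA_p (p : ℕ) (hp : p.Prime) (v : ℕ)
    (hv : orderOf (v : ZMod p) = p - 1)
    (vn : ℤ → ℕ)
    (hvn : ∀ n : ℕ, (vn (n : ℤ) : ZMod p) = (v : ZMod p) ^ n)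
    (hp8 : p % 8 = 5) :
    (p : ℤ) ∣ 
    ((∑ i ∈ Finset.range ((p - 1) / 2), (-1 : ℤ) ^ i * (vn ((2 * i : ℕ) : ℤ) : ℤ)) ^ 2 +
     (∑ i ∈ Finset.range ((p - 1) / 2), (-1 : ℤ) ^ i * (vn ((2 * i + 1 : ℕ) : ℤ) : ℤ)) ^ 2) := by
  haveI : Fact p.Prime := ⟨hp⟩
  rw [← CharP.intCast_eq_zero_iff (ZMod p) p]
  push_cast
  have e1 : ∀ i : ℕ, (vn (2 * (i : ℤ)) : ZMod p) = v ^ (2 * i) := fun i => by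
    rw [← hvn]; push_cast; rfl
  have e2 : ∀ i : ℕ, (vn (2 * (i : ℤ) + 1) : ZMod p) = v ^ (2 * i + 1) := fun i => by
    rw [← hvn]; push_cast; rfl
  simp_rw [e1, e2]
  have hB : ∑ i ∈ Finset.range ((p - 1) / 2), (-1 : ZMod p) ^ i * (v : ZMod p) ^ (2 * i + 1) =
      v * ∑ i ∈ Finset.range ((p - 1) / 2), (-1 : ZMod p) ^ i * (v : ZMod p) ^ (2 * i) := by
    rw [Finset.mul_sum]; refine Finset.sum_congr rfl fun i _ => by ring
  have hA : (∑ i ∈ Finset.range ((p - 1) / 2), (-1 : ZMod p) ^ i * (v : ZMod p) ^ (2 * i)) * (-(v:ZMod p)^2 - 1) = 0 := by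
    have : ∀ i : ℕ, (-1 : ZMod p) ^ i * (v : ZMod p) ^ (2 * i) = (-(v:ZMod p)^2)^i := fun i => by
      rw [neg_eq_neg_one_mul ((v:ZMod p)^2), mul_pow, pow_mul]
    simp_rw [this]
    rw [geom_sum_mul, Even.neg_pow (by rw [Nat.even_iff]; omega), ← pow_mul, show 2 * ((p-1)/2) = p - 1 by omega,
      ← hv, pow_orderOf_eq_one, sub_self]
  rw [hB]
  linear_combination (-∑ i ∈ Finset.range ((p - 1) / 2), (-1 : ZMod p) ^ i * (v : ZMod p) ^ (2 * i)) * hA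
end PartA

section PartB2
open Filter Topology Finset

lemma byparts_fin (c w : ℕ → ℂ) (N : ℕ) :
    ∑ i ∈ range N, c i * w i = ∑ i ∈ range N, (∑ j ∈ range (i+1), c j) * (w i - w (i+1))
      + (∑ i ∈ range N, c i) * w N := by
  induction N with
  | zero => simp
  | succ n ih => 
    rw [sum_range_succ, ih, sum_range_succ _ n, sum_range_succ c n]; ring

lemma byparts_tendsto (c w : ℕ → ℂ) (C : ℝ) (hc : ∀ n, ‖∑ i ∈ range n, c i‖ ≤ C)
    (hw : Tendsto w atTop (𝓝 0))
    (hs : Summable fun i => (∑ j ∈ range (i+1), c j) * (w i - w (i+1))) :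
    Tendsto (fun N => ∑ i ∈ range N, c i * w i) atTop
      (𝓝 (∑' i, (∑ j ∈ range (i+1), c j) * (w i - w (i+1)))) := by
  simp_rw [byparts_fin c w]
  rw [← add_zero (∑' i, _)]
  refine hs.hasSum.tendsto_sum_nat.add ?_
  apply squeeze_zero_norm (a := fun n => C * ‖w n‖)
  · intro n; rw [norm_mul]; gcongr; exact hc n
  · simpa using hw.norm.const_mul C

lemma wbound (s : ℝ) (hs1 : 1 ≤ s) (hs2 : s ≤ 2) (n : ℕ) :
    |((n:ℝ)+1)^(-s) - ((n:ℝ)+1+1)^(-s)| ≤ 2 / ((n:ℝ)+1)^2 := by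
  have h1 : (0:ℝ) < (n:ℝ)+1 := by positivity
  have h2 : (0:ℝ) < (n:ℝ)+1+1 := by positivity
  have hr : ((n:ℝ)+1+1)^(-s) = ((n:ℝ)+1)^(-s) * (((n:ℝ)+1)/((n:ℝ)+1+1))^s := by
    rw [Real.div_rpow h1.le h2.le, Real.rpow_neg h1.le, Real.rpow_neg h2.le]
    have := (Real.rpow_pos_of_pos h1 s).ne'
    field_simp
  have hq0 : (0:ℝ) < ((n:ℝ)+1)/((n:ℝ)+1+1) := by positivity
  have hq1 : ((n:ℝ)+1)/((n:ℝ)+1+1) ≤ 1 := by rw [div_le_one h2]; linarith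
  have ha : (((n:ℝ)+1)/((n:ℝ)+1+1))^s ≤ 1 := Real.rpow_le_one hq0.le hq1 (by linarith)
  have hb : (((n:ℝ)+1)/((n:ℝ)+1+1))^(2:ℝ) ≤ (((n:ℝ)+1)/((n:ℝ)+1+1))^s :=
    Real.rpow_le_rpow_of_exponent_ge hq0 hq1 hs2
  have hc : 1 - 2/((n:ℝ)+1) ≤ (((n:ℝ)+1)/((n:ℝ)+1+1))^(2:ℝ) := by
    rw [Real.rpow_two]
    have : ((n:ℝ)+1)/((n:ℝ)+1+1) ≥ 1 - 1/((n:ℝ)+1) := by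
      rw [ge_iff_le, sub_le_iff_le_add, div_add_div _ _ h2.ne' h1.ne', le_div_iff₀ (by positivity)]
      nlinarith
    have h3 : 2/((n:ℝ)+1) = 2 * (1/((n:ℝ)+1)) := by ring
    rw [h3]
    have h4 : 1/((n:ℝ)+1) ≤ 1 := by rw [div_le_one h1]; linarith [(Nat.cast_nonneg n : (0:ℝ) ≤ n)]
    nlinarith [sq_nonneg (1/((n:ℝ)+1))]
  have hd : ((n:ℝ)+1)^(-s) ≤ 1/((n:ℝ)+1) := by
    rw [one_div, ← Real.rpow_neg_one]
    apply Real.rpow_le_rpow_of_exponent_le <;> linarith [(Nat.cast_nonneg n : (0:ℝ) ≤ n)]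
  have hd0 : 0 ≤ ((n:ℝ)+1)^(-s) := by positivity
  rw [hr, show ((n:ℝ)+1)^(-s) - ((n:ℝ)+1)^(-s) * (((n:ℝ)+1)/((n:ℝ)+1+1))^s = ((n:ℝ)+1)^(-s) * (1 - (((n:ℝ)+1)/((n:ℝ)+1+1))^s) by ring, abs_of_nonneg (mul_nonneg hd0 (by linarith))]
  calc _ ≤ 1/((n:ℝ)+1) * (2/((n:ℝ)+1)) := by
        apply mul_le_mul hd _ (by linarith) (by positivity)
        linarith
    _ = _ := by field_simp

/-- Dirichlet-type test: limit at `1` of the Dirichlet series equals the sum at `1`. -/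
lemma exists_lim (c : ℕ → ℂ) (C : ℝ) (hc : ∀ n, ‖∑ i ∈ range n, c i‖ ≤ C) :
    ∃ l : ℂ, Tendsto (fun N => ∑ i ∈ range N, c i * (((i:ℝ)+1)^(-1:ℝ) : ℝ)) atTop (𝓝 l) ∧
    ∀ F : ℝ → ℂ, (∀ s > 1, HasSum (fun i => c i * (((i:ℝ)+1)^(-s) : ℝ)) (F s)) →
      Tendsto F (𝓝[>] 1) (𝓝 l) := by
  have hC : 0 ≤ C := (norm_nonneg _).trans (hc 0)
  let T : ℝ → ℕ → ℂ := fun s i => (∑ j ∈ range (i+1), c j) * (((((i:ℝ)+1)^(-s) : ℝ):ℂ) - ((((i+1:ℕ):ℝ)+1)^(-s) : ℝ))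
  have hb : ∀ s, 1 ≤ s → s ≤ 2 → ∀ i, ‖T s i‖ ≤ C * (2 / ((i:ℝ)+1)^2) := by
    intro s h1 h2 i
    simp only [T]
    rw [norm_mul, ← Complex.ofReal_sub, Complex.norm_real, Real.norm_eq_abs]
    push_cast
    exact mul_le_mul (hc _) (wbound s h1 h2 i) (abs_nonneg _) hC
  have hsb : Summable fun i : ℕ => C * (2 / ((i:ℝ)+1)^2) := by
    apply Summable.mul_left
    have := (summable_nat_add_iff 1).mpr (Real.summable_one_div_nat_pow.mpr (one_lt_two))
    simpa [div_eq_mul_inv] using this.mul_left 2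
  have hts : ∀ s, 1 ≤ s → s ≤ 2 → Summable (T s) := fun s h1 h2 =>
    Summable.of_norm_bounded hsb (hb s h1 h2)
  have hw : ∀ s : ℝ, 1 ≤ s → Tendsto (fun i : ℕ => ((((i:ℝ)+1)^(-s) : ℝ):ℂ)) atTop (𝓝 0) := by
    intro s hs
    rw [← Complex.ofReal_zero]
    apply (Complex.continuous_ofReal.tendsto _).comp
    exact (tendsto_rpow_neg_atTop (by linarith)).comp (tendsto_atTop_add_const_right _ _ tendsto_natCast_atTop_atTop)
  refine ⟨∑' i, T 1 i, byparts_tendsto c _ C hc (hw 1 le_rfl) (hts 1 le_rfl one_le_two), ?_⟩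
  intro F hF
  have heq : ∀ᶠ s in 𝓝[>] (1:ℝ), ∑' i, T s i = F s := by
    filter_upwards [Ioc_mem_nhdsGT (one_lt_two : (1:ℝ) < 2)] with s hs
    exact tendsto_nhds_unique (byparts_tendsto c _ C hc (hw s hs.1.le) (hts s hs.1.le hs.2)) (hF s hs.1).tendsto_sum_nat
  refine Tendsto.congr' heq ?_
  refine tendsto_tsum_of_dominated_convergence hsb ?_ ?_
  · intro i
    apply Tendsto.mono_left _ nhdsWithin_le_nhds
    have : Continuous (fun s => T s i) := by
      have h1 : (0:ℝ) < (i:ℝ)+1 := by positivity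
      have h2 : (0:ℝ) < ((i+1:ℕ):ℝ)+1 := by positivity
      apply Continuous.mul continuous_const
      apply Continuous.sub <;> apply Complex.continuous_ofReal.comp
      · exact Continuous.rpow continuous_const continuous_neg (fun _ => Or.inl h1.ne')
      · exact Continuous.rpow continuous_const continuous_neg (fun _ => Or.inl h2.ne')
    exact this.tendsto 1
  · filter_upwards [Ioc_mem_nhdsGT (one_lt_two : (1:ℝ) < 2)] with s hs
    exact hb s hs.1.le hs.2

lemma char_psum (p : ℕ) [Fact p.Prime] (χ : DirichletCharacter ℂ p) (hχ : χ ≠ 1) :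
    ∀ n, ‖∑ i ∈ range n, χ ((i + 1 : ℕ) : ZMod p)‖ ≤ p := by
  have hp : ∑ i ∈ range p, χ ((i + 1 : ℕ) : ZMod p) = 0 := by
    rw [← MulChar.sum_eq_zero_of_ne_one hχ, ← Equiv.sum_comp (Equiv.addRight (1 : ZMod p)) (fun a => χ a)]
    refine sum_nbij' (fun i => (i : ZMod p)) (fun a => a.val) ?_ ?_ ?_ ?_ ?_
    · simp
    · intro a _; simpa using a.val_lt
    · intro i hi; simpa using ZMod.val_cast_of_lt (by simpa using hi)
    · intro a _; simp
    · intro i hi; simp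
  intro n
  induction n using Nat.strong_induction_on with
  | _ n ih =>
    rcases lt_or_ge n p with h | h
    · refine (norm_sum_le _ _).trans ?_
      calc _ ≤ ∑ i ∈ range n, (1:ℝ) := sum_le_sum fun i _ => χ.norm_le_one _
        _ ≤ p := by simpa using h.le
    · obtain ⟨m, rfl⟩ := Nat.exists_eq_add_of_le h
      rw [sum_range_add, hp, zero_add]
      have := ih m (by have := (Fact.out : p.Prime).pos; omega)
      have h9 : ∀ i : ℕ, ((p + i + 1 : ℕ) : ZMod p) = ((i + 1 : ℕ) : ZMod p) := by intro i; simp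
      simp_rw [h9]; exact this
open Complex in
lemma char_abel (p : ℕ) [Fact p.Prime] (χ : DirichletCharacter ℂ p) (hχ : χ ≠ 1) :
    Tendsto (fun x : ℝ => ∑' n : ℕ, (χ (n : ZMod p) / n) * (x:ℂ) ^ n) (𝓝[<] 1)
      (𝓝 (DirichletCharacter.LFunction χ 1)) := by
  obtain ⟨l, h1, h2⟩ := exists_lim (fun i => χ ((i + 1 : ℕ) : ZMod p)) p (char_psum p χ hχ)
  have hl : l = DirichletCharacter.LFunction χ 1 := by
    have h3 := h2 (fun s => DirichletCharacter.LFunction χ s) (by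
      intro s hs
      rw [DirichletCharacter.LFunction_eq_LSeries _ (by simpa using hs)]
      have := DirichletCharacter.LSeriesSummable_of_one_lt_re χ (s := s) (by simpa using hs)
      have h4 := (hasSum_nat_add_iff' 1).mpr this.LSeriesHasSum
      simp only [range_one, sum_singleton, LSeries.term_zero, sub_zero] at h4
      refine h4.congr_fun ?_ |> fun h => h
      intro i
      rw [LSeries.term_of_ne_zero (by omega), div_eq_mul_inv, ← cpow_neg]
      rw [ofReal_cpow (by positivity)]
      push_cast; rfl)
    refine tendsto_nhds_unique h3 ?_
    refine Tendsto.mono_left ?_ nhdsWithin_le_nhds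
    exact (((DirichletCharacter.differentiable_LFunction hχ).continuous).comp continuous_ofReal).tendsto' _ _ (by simp)
  rw [← hl]
  have h5 : Tendsto (fun n ↦ ∑ i ∈ range n, (χ (i : ZMod p) / i)) atTop (𝓝 l) := by
    rw [← tendsto_add_atTop_iff_nat 1]
    refine h1.congr fun n => ?_
    rw [sum_range_succ']
    simp only [Nat.cast_zero, div_zero, add_zero]
    refine sum_congr rfl fun i _ => ?_
    rw [Real.rpow_neg_one, div_eq_mul_inv]; push_cast; rfl
  exact tendsto_map'_iff.mp (Complex.tendsto_tsum_powerSeries_nhdsWithin_lt h5)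

open Complex in
lemma gauss_log (p : ℕ) [Fact p.Prime] (χ : DirichletCharacter ℂ p) (hχ : χ ≠ 1) :
    gaussSum χ⁻¹ (ZMod.stdAddChar (N := p)) * DirichletCharacter.LFunction χ 1 =
      - ∑ a : ZMod p, χ⁻¹ a * log (1 - ZMod.stdAddChar a) := by
  have hlim : Tendsto (fun x : ℝ => - ∑ a : ZMod p, χ⁻¹ a * log (1 - ZMod.stdAddChar a * x)) (𝓝[<] 1)
      (𝓝 (- ∑ a : ZMod p, χ⁻¹ a * log (1 - ZMod.stdAddChar a))) := by
    apply Tendsto.neg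
    apply tendsto_finsetSum
    intro a _
    by_cases ha : a = 0
    · subst ha; simp [MulChar.map_zero]
    apply Tendsto.const_mul
    refine Tendsto.mono_left ?_ nhdsWithin_le_nhds
    have hsl : 1 - (ZMod.stdAddChar a : ℂ) * ((1:ℝ):ℂ) ∈ slitPlane := by
      have hn : ‖(ZMod.stdAddChar a : ℂ)‖ = 1 := AddChar.norm_apply _ _
      have hne : (ZMod.stdAddChar a : ℂ) ≠ 1 := by
        intro h; apply ha
        exact ZMod.injective_stdAddChar (by rw [h, AddChar.map_zero_eq_one])
      left
      simp only [ofReal_one, mul_one, sub_re, one_re]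
      have := re_le_norm (ZMod.stdAddChar a : ℂ)
      rcases lt_or_eq_of_le (hn ▸ this) with h | h
      · linarith
      · exfalso; apply hne
        have h6 := Complex.sq_norm (ZMod.stdAddChar a : ℂ)
        rw [hn, normSq_apply, h] at h6
        apply Complex.ext
        · simpa using h
        · simpa using h6
    have : ContinuousAt (fun x : ℝ => log (1 - ZMod.stdAddChar a * x)) 1 := by
      exact ContinuousAt.clog (f := fun x : ℝ => 1 - ZMod.stdAddChar a * (x:ℂ)) (by fun_prop) hsl
    simpa using this.tendsto
  refine tendsto_nhds_unique ((char_abel p χ hχ).const_mul _) (hlim.congr' ?_)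
  filter_upwards [Ioo_mem_nhdsLT (zero_lt_one : (0:ℝ) < 1)] with x hx
  have hprim : (χ⁻¹).IsPrimitive := by
    have hne : χ⁻¹ ≠ 1 := inv_ne_one.mpr hχ
    rw [Ne, DirichletCharacter.eq_one_iff_conductor_eq_one] at hne
    exact ((Nat.dvd_prime Fact.out).mp (DirichletCharacter.conductor_dvd_level χ⁻¹)).resolve_left hne
  have hs : ∀ a : ZMod p, HasSum (fun n : ℕ => χ⁻¹ a * ((ZMod.stdAddChar a * (x:ℂ)) ^ n / n))
      (χ⁻¹ a * -log (1 - ZMod.stdAddChar a * x)) := by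
    intro a
    apply HasSum.mul_left
    apply hasSum_taylorSeries_neg_log
    rw [norm_mul, AddChar.norm_apply, one_mul, norm_real, Real.norm_eq_abs, abs_of_pos hx.1]
    exact hx.2
  have hs2 := hasSum_sum (fun a (_ : a ∈ univ) => hs a)
  rw [← tsum_mul_left]
  simp_rw [mul_neg, sum_neg_distrib] at hs2
  rw [← hs2.tsum_eq]
  congr 1; ext n
  have := gaussSum_mulShift_of_isPrimitive (ZMod.stdAddChar (N := p)) hprim (n : ZMod p)
  rw [inv_inv] at this
  rw [show gaussSum χ⁻¹ (ZMod.stdAddChar (N := p)) * (χ (n : ZMod p) / n * (x:ℂ)^n) = (χ (n : ZMod p) * gaussSum χ⁻¹ (ZMod.stdAddChar (N := p))) * ((x:ℂ)^n / n) by ring, ← this, gaussSum, sum_mul]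
  refine sum_congr rfl fun a _ => ?_
  rw [AddChar.mulShift_apply, mul_pow, ← AddChar.map_nsmul_eq_pow, nsmul_eq_mul]
  ring

open Complex in
lemma log_one_sub_exp (t : ℝ) (h0 : 0 < t) (h1 : t < Real.pi) :
    log (1 - exp (2 * t * I)) = (Real.log (2 * Real.sin t) : ℝ) + (t - Real.pi / 2) * I := by
  have hs : 0 < Real.sin t := Real.sin_pos_of_pos_of_lt_pi h0 h1
  have : 1 - exp (2 * t * I) = exp ((Real.log (2 * Real.sin t) : ℝ) + (t - Real.pi / 2) * I) := by
    rw [exp_add, ← ofReal_exp, Real.exp_log (by positivity), sub_mul, exp_sub, exp_pi_div_two_mul_I]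
    push_cast
    rw [Complex.sin]
    have h2 : exp (2 * t * I) = exp (t * I) * exp (t * I) := by rw [← exp_add]; ring_nf
    have h3 : exp (-t * I) * exp (t * I) = 1 := by rw [← exp_add]; simp
    rw [h2]
    field_simp
    rw [show -(t:ℂ) * I = -(t * I) by ring] at h3
    linear_combination - h3
  rw [this, log_exp]
  · simp; linarith [Real.pi_pos]
  · simp; linarith [Real.pi_pos]

open Complex in
lemma gauss_L (p : ℕ) [Fact p.Prime] (χ : DirichletCharacter ℂ p) (hχ : χ.Odd) :
    gaussSum χ⁻¹ (ZMod.stdAddChar (N := p)) * DirichletCharacter.LFunction χ 1 =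
      - (Real.pi * I / p) * ∑ a : ZMod p, χ⁻¹ a * a.val := by
  have hp : (0:ℝ) < p := by exact_mod_cast (Fact.out : p.Prime).pos
  have hχ1 : χ ≠ 1 := by
    rintro rfl
    have := hχ
    rw [DirichletCharacter.Odd, MulChar.one_apply (by simp)] at this
    norm_num at this
  have hodd : χ⁻¹ (-1) = -1 := by
    rw [MulChar.inv_apply_eq_inv', hχ]; norm_num
  have key : ∀ a : ZMod p, χ⁻¹ a * log (1 - ZMod.stdAddChar a) =
      χ⁻¹ a * (Real.log (2 * Real.sin (Real.pi * a.val / p)) : ℝ) +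
      (Real.pi * I / p) * (χ⁻¹ a * a.val) - (Real.pi / 2 * I) * χ⁻¹ a := by
    intro a
    by_cases ha : a = 0
    · subst ha; simp [MulChar.map_zero]
    have hv : (0:ℝ) < a.val := by
      have : a.val ≠ 0 := by simpa using ha
      exact_mod_cast Nat.pos_of_ne_zero this
    have hv2 : (a.val : ℝ) < p := by exact_mod_cast a.val_lt
    have := log_one_sub_exp (Real.pi * a.val / p) (by positivity) (by
      rw [div_lt_iff₀ hp]; exact mul_lt_mul_of_pos_left hv2 Real.pi_pos)
    rw [show (ZMod.stdAddChar a : ℂ) = exp (2 * (Real.pi * a.val / p : ℝ) * I) by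
      conv_lhs => rw [← ZMod.natCast_zmod_val a]
      have := ZMod.stdAddChar_coe (N := p) (a.val : ℤ)
      push_cast at this ⊢
      rw [this]; congr 1; ring, this]
    push_cast
    ring
  rw [gauss_log p χ hχ1]
  simp_rw [key]
  rw [sum_sub_distrib, sum_add_distrib, ← mul_sum, ← mul_sum, MulChar.sum_eq_zero_of_ne_one (inv_ne_one.mpr hχ1)]
  have h0 : ∑ a : ZMod p, χ⁻¹ a * (Real.log (2 * Real.sin (Real.pi * a.val / p)) : ℝ) = 0 := by
    have h := Equiv.sum_comp (Equiv.neg (ZMod p)) (fun a => χ⁻¹ a * ((Real.log (2 * Real.sin (Real.pi * a.val / p)) : ℝ) : ℂ))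
    have h' : ∀ a : ZMod p, χ⁻¹ (-a) * ((Real.log (2 * Real.sin (Real.pi * (-a).val / p)) : ℝ) : ℂ) =
       - (χ⁻¹ a * ((Real.log (2 * Real.sin (Real.pi * a.val / p)) : ℝ) : ℂ)) := by
      intro a
      by_cases ha : a = 0
      · subst ha; simp [MulChar.map_zero]
      have : NeZero a := ⟨ha⟩
      rw [← neg_one_mul, map_mul, hodd, neg_one_mul a, ZMod.val_neg_of_ne_zero, Nat.cast_sub a.val_lt.le]
      rw [show Real.pi * (p - a.val) / p = Real.pi - Real.pi * a.val / p by field_simp, Real.sin_pi_sub]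
      ring
    simp only [Equiv.neg_apply, h', sum_neg_distrib] at h
    exact self_eq_neg.mp h.symm
  rw [h0]; ring

open Complex in
lemma L_mul_L (p : ℕ) [Fact p.Prime] (χ : DirichletCharacter ℂ p) (hχ : χ.Odd) :
    DirichletCharacter.LFunction χ 1 * DirichletCharacter.LFunction χ⁻¹ 1 =
      (Real.pi ^ 2 / p ^ 3) * ((∑ a : ZMod p, χ a * a.val) * ∑ a : ZMod p, χ⁻¹ a * a.val) := by
  have hp : (p:ℂ) ≠ 0 := by exact_mod_cast (Fact.out : p.Prime).ne_zero
  have hχ1 : χ ≠ 1 := by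
    rintro rfl
    have := hχ
    rw [DirichletCharacter.Odd, MulChar.one_apply (by simp)] at this
    norm_num at this
  have hodd : χ⁻¹ (-1) = -1 := by
    rw [MulChar.inv_apply_eq_inv', hχ]; norm_num
  have h1 := gauss_L p χ hχ
  have h2 := gauss_L p χ⁻¹ hodd
  rw [inv_inv] at h2
  have h3 := gaussSum_mul_gaussSum_eq_card hχ1 (ZMod.isPrimitive_stdAddChar p)
  have h4 : gaussSum χ⁻¹ (ZMod.stdAddChar (N := p))⁻¹ = - gaussSum χ⁻¹ (ZMod.stdAddChar (N := p)) := by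
    rw [gaussSum, gaussSum, ← Equiv.sum_comp (Equiv.neg (ZMod p)), ← sum_neg_distrib]
    refine sum_congr rfl fun a _ => ?_
    simp only [Equiv.neg_apply, AddChar.inv_apply, neg_neg]
    rw [← neg_one_mul, map_mul, hodd]; ring
  rw [h4, ZMod.card] at h3
  have h5 : (-(p:ℂ)) * (DirichletCharacter.LFunction χ 1 * DirichletCharacter.LFunction χ⁻¹ 1) =
     (-(p:ℂ)) * ((Real.pi ^ 2 / p ^ 3) * ((∑ a : ZMod p, χ a * a.val) * ∑ a : ZMod p, χ⁻¹ a * a.val)) := by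
    rw [← h3]
    have : ∀ a b c d : ℂ, -(a * -b) * (c * d) = (b * c) * (a * d) := by intros; ring
    rw [this, h1, h2, h3]
    field_simp
    rw [I_sq]; ring
  exact mul_left_cancel₀ (neg_ne_zero.mpr hp) h5
end PartB2

section PartB3
open Filter Topology Finset

open Complex in
lemma exists_char (p : ℕ) [Fact p.Prime] (v : ℕ) (hv : orderOf (v : ZMod p) = p - 1)
    (hp8 : p % 8 = 5) : ∃ χ : DirichletCharacter ℂ p, χ (v : ZMod p) = I ∧ χ.Odd := by
  have hv0 : (v : ZMod p) ≠ 0 := by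
    intro h; rw [h, orderOf_zero] at hv; omega
  let u : (ZMod p)ˣ := Units.mk0 _ hv0
  have hu : orderOf u = p - 1 := by rw [← hv, ← orderOf_units]; rfl
  have hg : ∀ x, x ∈ Subgroup.zpowers u := by
    intro x
    have : Subgroup.zpowers u = ⊤ := by
      apply Subgroup.eq_top_of_card_eq
      rw [Nat.card_zpowers, hu, Nat.card_eq_fintype_card, ZMod.card_units]
    rw [this]; trivial
  let μ : ℂˣ := Units.mk0 I I_ne_zero
  have hμ : μ ∈ rootsOfUnity (Fintype.card (ZMod p)ˣ) ℂ := by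
    rw [_root_.mem_rootsOfUnity, ZMod.card_units]
    ext
    simp only [Units.val_pow_eq_pow_val, μ, Units.val_mk0, Units.val_one]
    obtain ⟨k, hk⟩ : ∃ k, p - 1 = 4 * k := ⟨(p-1)/4, by omega⟩
    rw [hk, pow_mul, I_pow_four, one_pow]
  refine ⟨MulChar.ofRootOfUnity hμ hg, MulChar.ofRootOfUnity_spec hμ hg, ?_⟩
  set χ : DirichletCharacter ℂ p := MulChar.ofRootOfUnity hμ hg with hχ
  have hs : χ (v : ZMod p) = I := MulChar.ofRootOfUnity_spec hμ hg
  obtain ⟨k, hk⟩ : ∃ k, p = 8 * k + 5 := ⟨p / 8, by omega⟩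
  have hhalf : (v : ZMod p) ^ (2 * (2 * k + 1)) = -1 := by
    have h1 : ((v : ZMod p) ^ (2 * (2 * k + 1))) ^ 2 = 1 := by
      rw [← pow_mul, show 2 * (2 * k + 1) * 2 = p - 1 by omega, ← hv, pow_orderOf_eq_one]
    rcases mul_self_eq_one_iff.mp ((sq _).symm.trans h1) with h | h
    · exfalso
      have := orderOf_dvd_of_pow_eq_one h
      rw [hv] at this
      have := Nat.le_of_dvd (by omega) this
      omega
    · exact h
  rw [DirichletCharacter.Odd, ← hhalf, map_pow, hs, pow_mul, I_sq, Odd.neg_one_pow ⟨k, rfl⟩]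

lemma sum_zmod_eq (p : ℕ) [Fact p.Prime] (v : ℕ) (hv : orderOf (v : ZMod p) = p - 1)
    (vn : ℤ → ℕ)
    (hvn1 : ∀ n : ℤ, 1 ≤ vn n) (hvn2 : ∀ n : ℤ, vn n ≤ p - 1)
    (hvn : ∀ n : ℕ, (vn (n : ℤ) : ZMod p) = (v : ZMod p) ^ n)
    (χ : DirichletCharacter ℂ p) (c : ℂ) (hc : χ (v : ZMod p) = c) (hp8 : p % 8 = 5) (hc2 : c^2 = -1):
    ∑ a : ZMod p, χ a * a.val =
    ((∑ i ∈ Finset.range ((p - 1) / 2), (-1 : ℤ) ^ i * (vn ((2 * i : ℕ) : ℤ) : ℤ) : ℤ) : ℂ) +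
     c * ((∑ i ∈ Finset.range ((p - 1) / 2), (-1 : ℤ) ^ i * (vn ((2 * i + 1 : ℕ) : ℤ) : ℤ) : ℤ) : ℂ) := by
  have hv0 : (v : ZMod p) ≠ 0 := by
    intro h; rw [h, orderOf_zero] at hv; omega
  have hpp := (Fact.out : p.Prime).two_le
  have h1 : ∑ a : ZMod p, χ a * a.val = ∑ i ∈ range (p - 1), c ^ i * (vn (i : ℤ) : ℂ) := by
    rw [← sum_erase univ (a := (0 : ZMod p)) (by simp)]
    symm
    have hinj : Set.InjOn (fun i => (v : ZMod p) ^ i) (range (p-1) : Finset ℕ) := by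
      intro i hi j hj hij
      have := pow_injOn_Iio_orderOf (x := (v : ZMod p))
      rw [hv] at this
      exact this (by simpa using hi) (by simpa using hj) hij
    have himg : (range (p-1)).image (fun i => (v : ZMod p) ^ i) = univ.erase 0 := by
      apply eq_of_subset_of_card_le
      · intro x hx
        obtain ⟨i, -, rfl⟩ := mem_image.mp hx
        exact mem_erase.mpr ⟨pow_ne_zero i hv0, mem_univ _⟩
      · rw [card_image_of_injOn hinj, card_erase_of_mem (mem_univ _), card_univ, ZMod.card, card_range]
    rw [← himg, sum_image hinj]
    refine sum_congr rfl fun i _ => ?_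
    rw [map_pow, hc, ← hvn i, ZMod.val_cast_of_lt (by have := hvn2 i; omega)]
  rw [h1]
  have hr : ∀ n, ∑ i ∈ range (2 * n), c ^ i * (vn (i : ℤ) : ℂ) =
    ((∑ i ∈ Finset.range n, (-1 : ℤ) ^ i * (vn ((2 * i : ℕ) : ℤ) : ℤ) : ℤ) : ℂ) +
     c * ((∑ i ∈ Finset.range n, (-1 : ℤ) ^ i * (vn ((2 * i + 1 : ℕ) : ℤ) : ℤ) : ℤ) : ℂ) := by
    intro n
    induction n with
    | zero => simp
    | succ n ih =>
      rw [show 2 * (n + 1) = 2 * n + 1 + 1 by ring, sum_range_succ, sum_range_succ, ih, sum_range_succ, sum_range_succ, pow_succ, pow_mul, hc2]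
      push_cast
      ring
  rw [← hr, show 2 * ((p-1)/2) = p - 1 by omega]
end PartB3

section PartC2
open Finset ENNReal

def suppSet {α : Type*} [CommMonoidWithZero α] (T : Finset α) : Set α :=
  {x | x ≠ 0 ∧ ∀ q, Prime q → q ∣ x → q ∈ T}

lemma euler_fin {α : Type*} [CommMonoidWithZero α] [UniqueFactorizationMonoid α] [Unique αˣ] [Nontrivial α]
    (w : α → ℝ≥0∞) (w1 : w 1 = 1) (wm : ∀ x y, w (x * y) = w x * w y) (T : Finset α)
    (hT : ∀ q ∈ T, Prime q) :
    ∑' x : suppSet T, w x = ∏ q ∈ T, (1 - w q)⁻¹ := by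
  classical
  have wpow : ∀ x k, w (x ^ k) = w x ^ k := by
    intro x k
    induction k with
    | zero => simp [w1]
    | succ k ih => rw [pow_succ, wm, ih, pow_succ]
  induction T using Finset.induction_on with
  | empty =>
    have h : ∀ x : α, x ∈ suppSet (∅ : Finset α) ↔ x = 1 := by
      intro x
      constructor
      · rintro ⟨h0, h⟩
        by_contra hx
        have hu : ¬ IsUnit x := fun hu => hx (isUnit_iff_eq_one.mp hu)
        obtain ⟨q, hq, hd⟩ := WfDvdMonoid.exists_irreducible_factor hu h0
        exact absurd (h q hq.prime hd) (by simp)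
      · rintro rfl
        exact ⟨one_ne_zero, fun q hq hd => (hq.not_isUnit (isUnit_of_dvd_one hd)).elim⟩
    have : suppSet (∅ : Finset α) = {1} := Set.ext fun x => by rw [h]; rfl
    rw [this]
    simp [w1]
  | insert P T hP ih =>
    have hPp : Prime P := hT P (by simp)
    have ih := ih (fun q hq => hT q (by simp [hq]))
    rw [prod_insert hP, ← ih, ← ENNReal.tsum_geometric, ← ENNReal.tsum_mul_right]
    simp_rw [← ENNReal.tsum_mul_left]
    rw [← ENNReal.tsum_prod]
    have hndvd : ∀ y ∈ suppSet T, ¬ P ∣ y := fun y hy h => hP (hy.2 P hPp h)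
    have hmem : ∀ z : ℕ × suppSet T, P ^ z.1 * (z.2 : α) ∈ suppSet (insert P T) := by
      rintro ⟨k, y, hy⟩
      refine ⟨mul_ne_zero (pow_ne_zero _ hPp.ne_zero) hy.1, fun q hq hd => ?_⟩
      rcases hq.dvd_or_dvd hd with h | h
      · have := (hq.dvd_prime_iff_associated hPp).mp (hq.dvd_of_dvd_pow h)
        rw [associated_iff_eq] at this
        simp [this]
      · exact mem_insert_of_mem (hy.2 q hq h)
    let f : ℕ × suppSet T → suppSet (insert P T) := fun z => ⟨P ^ z.1 * z.2, hmem z⟩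
    have hf : Function.Bijective f := by
      constructor
      · rintro ⟨k, y, hy⟩ ⟨k', y', hy'⟩ h
        have h : P ^ k * y = P ^ k' * y' := congrArg Subtype.val h
        have aux : ∀ (a b : ℕ) (u u' : α), ¬ P ∣ u → P ^ a * u = P ^ b * u' → b ≤ a := by
          intro a b u u' hu hh
          by_contra! hlt
          obtain ⟨c, rfl⟩ := Nat.exists_eq_add_of_lt hlt
          rw [add_assoc, pow_add, mul_assoc] at hh
          have := mul_left_cancel₀ (pow_ne_zero _ hPp.ne_zero) hh
          rw [pow_succ'] at this
          exact hu ⟨P ^ c * u', by rw [this]; simp [mul_assoc]⟩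
        have hk : k = k' := le_antisymm (aux _ _ _ _ (hndvd y' hy') h.symm) (aux _ _ _ _ (hndvd y hy) h)
        subst hk
        have := mul_left_cancel₀ (pow_ne_zero _ hPp.ne_zero) h
        subst this
        rfl
      · rintro ⟨x, hx0, hx⟩
        have hfin : FiniteMultiplicity P x := FiniteMultiplicity.of_prime_left hPp hx0
        obtain ⟨y, hy, hnd⟩ := hfin.exists_eq_pow_mul_and_not_dvd
        have hymem : y ∈ suppSet T := by
          refine ⟨fun h => hx0 (by rw [hy, h, mul_zero]), fun q hq hd => ?_⟩
          have := hx q hq (hy ▸ hd.mul_left _)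
          rcases mem_insert.mp this with h | h
          · exact (hnd (h ▸ hd)).elim
          · exact h
        exact ⟨(multiplicity P x, ⟨y, hymem⟩), Subtype.ext hy.symm⟩
    rw [← (Equiv.ofBijective f hf).tsum_eq]
    refine tsum_congr fun z => ?_
    simp [f, wm, wpow]

/-- The total sum is the limit of an increasing sequence of finite Euler products. -/
lemma euler_lim {α : Type*} [CommMonoidWithZero α] [UniqueFactorizationMonoid α] [Unique αˣ] [Nontrivial α]
    (w : α → ℝ≥0∞) (w1 : w 1 = 1) (wm : ∀ x y, w (x * y) = w x * w y) (T : ℕ → Finset α)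
    (hTm : Monotone T)
    (hT : ∀ n, ∀ q ∈ T n, Prime q) (hTe : ∀ q, Prime q → ∃ n, q ∈ T n) :
    Filter.Tendsto (fun n => ∏ q ∈ T n, (1 - w q)⁻¹) Filter.atTop (nhds (∑' x : {x : α // x ≠ 0}, w x)) := by
  classical
  have hmono : Monotone (fun n => ∏ q ∈ T n, (1 - w q)⁻¹) := by
    intro m n hmn
    simp only
    rw [← euler_fin w w1 wm _ (hT m), ← euler_fin w w1 wm _ (hT n)]
    exact ENNReal.tsum_mono_subtype _ (fun x hx => ⟨hx.1, fun q hq hd => hTm hmn (hx.2 q hq hd)⟩)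
  have h := tendsto_atTop_iSup hmono
  convert h using 2
  apply le_antisymm
  · rw [ENNReal.tsum_eq_iSup_sum]
    refine iSup_le fun s => ?_
    have : ∃ n, ∀ x ∈ s, (x : α) ∈ suppSet (T n) := by
      have h1 : ∀ x : α, x ≠ 0 → ∃ n, x ∈ suppSet (T n) := by
        intro x hx
        have h2 : ∃ n, ∀ q ∈ (UniqueFactorizationMonoid.factors x).toFinset, q ∈ T n := by
          choose! N hN using hTe
          refine ⟨(UniqueFactorizationMonoid.factors x).toFinset.sup N, fun q hq => ?_⟩
          exact hTm (le_sup (f := N) hq) (hN q (UniqueFactorizationMonoid.prime_of_factor q (Multiset.mem_toFinset.mp hq)))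
        obtain ⟨n, hn⟩ := h2
        refine ⟨n, hx, fun q hq hd => ?_⟩
        obtain ⟨q', hq', ha⟩ := UniqueFactorizationMonoid.exists_mem_factors_of_dvd hx hq.irreducible hd
        rw [associated_iff_eq] at ha
        exact hn q (Multiset.mem_toFinset.mpr (ha ▸ hq'))
      choose! N hN using h1
      refine ⟨s.sup (fun x => N x), fun x hx => ?_⟩
      have h3 := hN x x.2
      exact ⟨h3.1, fun q hq hd => hTm (le_sup (f := fun x : {x : α // x ≠ 0} => N x) hx) (h3.2 q hq hd)⟩
    obtain ⟨n, hn⟩ := this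
    refine le_trans ?_ (le_iSup _ n)
    rw [← euler_fin w w1 wm _ (hT n)]
    let g : s → suppSet (T n) := fun x => ⟨x.1.1, hn _ x.2⟩
    have hg : Function.Injective g := by
      intro a b hab
      apply Subtype.ext; apply Subtype.ext
      exact congrArg (fun z : suppSet (T n) => (z : α)) hab
    rw [← Finset.sum_coe_sort s, ← tsum_fintype (L := .unconditional _)]
    exact ENNReal.tsum_comp_le_tsum_of_injective hg (fun x : suppSet (T n) => w x)
  · refine iSup_le fun n => ?_
    rw [← euler_fin w w1 wm _ (hT n)]
    exact ENNReal.tsum_mono_subtype w (s := suppSet (T n)) (t := {x | x ≠ 0}) (fun x hx => hx.1)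

open NumberField Ideal Filter Topology in
lemma zeta_of_local (F : Type*) [Field F] [NumberField F] (s : ℝ) (hs : 1 < s) (f g : ℕ → ℕ)
    (hf : ∀ l : ℕ, l.Prime → ∀ P ∈ primesOver (span {(l:ℤ)}) (𝓞 F), absNorm P = l ^ f l)
    (hf0 : ∀ l : ℕ, l.Prime → f l ≠ 0)
    (hg : ∀ l : ℕ, l.Prime → (primesOver (span {(l:ℤ)}) (𝓞 F)).ncard = g l) (E : ℝ)
    (hE : Tendsto (fun N : ℕ => ∏ l ∈ N.primesBelow, ((1-((l:ℝ)^(-s))^(f l))⁻¹)^(g l)) atTop (𝓝 E)) :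
    dedekindZeta F s = (E : ℂ) := by
  classical
  let w : Ideal (𝓞 F) → ℝ≥0∞ := fun I => ENNReal.ofReal ((absNorm I : ℝ) ^ (-s))
  have w1 : w 1 = 1 := by simp [w]
  have wm : ∀ x y, w (x * y) = w x * w y := by
    intro x y
    simp only [w, map_mul, Nat.cast_mul]
    rw [Real.mul_rpow (by positivity) (by positivity), ENNReal.ofReal_mul (by positivity)]
  have hfin : ∀ l : ℕ, (primesOver (span {(l:ℤ)}) (𝓞 F)).Finite := fun l =>
    Algebra.QuasiFinite.finite_primesOver _
  let T : ℕ → Finset (Ideal (𝓞 F)) := fun N => N.primesBelow.biUnion fun l => (hfin l).toFinset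
  have hbot : ∀ l : ℕ, l.Prime → span {(l:ℤ)} ≠ ⊥ := fun l hl => by
    simpa using hl.ne_zero
  have hTP : ∀ n, ∀ q ∈ T n, Prime q := by
    intro n q hq
    simp only [T, mem_biUnion, Set.Finite.mem_toFinset, Nat.mem_primesBelow] at hq
    obtain ⟨l, ⟨-, hl⟩, hq1, hq2⟩ := hq
    have := Ideal.ne_bot_of_liesOver_of_ne_bot (hbot l hl) q
    exact Ideal.prime_of_isPrime this hq1
  have hTm : Monotone T := by
    intro a b hab
    refine biUnion_subset_biUnion_of_subset_left _ fun l hl => ?_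
    rw [Nat.mem_primesBelow] at hl ⊢
    exact ⟨hl.1.trans_le hab, hl.2⟩
  have hTe : ∀ q, Prime q → ∃ n, q ∈ T n := by
    intro q hq
    have hqp := Ideal.isPrime_of_prime hq
    have : NeZero q := ⟨hq.ne_zero⟩
    have hl := Nat.absNorm_under_prime q
    refine ⟨absNorm (under ℤ q) + 1, ?_⟩
    simp only [T, mem_biUnion, Set.Finite.mem_toFinset, Nat.mem_primesBelow]
    refine ⟨_, ⟨Nat.lt_succ_self _, hl⟩, hqp, ?_⟩
    rw [liesOver_iff, Int.ideal_span_absNorm_eq_self]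
  have key := euler_lim w w1 wm T hTm hTP hTe
  have hprod : ∀ N : ℕ, ∏ q ∈ T N, (1 - w q)⁻¹ =
      ENNReal.ofReal (∏ l ∈ N.primesBelow, ((1-((l:ℝ)^(-s))^(f l))⁻¹)^(g l)) := by
    intro N
    have hpos : ∀ l : ℕ, l.Prime → 0 < 1-((l:ℝ)^(-s))^(f l) := by
      intro l hl
      rw [sub_pos]
      apply pow_lt_one₀ (by positivity) _ (hf0 l hl)
      exact Real.rpow_lt_one_of_one_lt_of_neg (by exact_mod_cast hl.one_lt) (by linarith)
    rw [prod_biUnion]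
    · rw [ENNReal.ofReal_prod_of_nonneg]
      · refine prod_congr rfl fun l hl => ?_
        have hl := (Nat.mem_primesBelow.mp hl).2
        rw [← hg l hl, Set.ncard_eq_toFinset_card _ (hfin l), ENNReal.ofReal_pow (inv_nonneg.mpr (hpos l hl).le)]
        apply prod_eq_pow_card
        intro q hq
        have hn := hf l hl q (by simpa using hq)
        have : w q = ENNReal.ofReal (((l:ℝ)^(-s))^(f l)) := by
          simp only [w, hn]
          congr 1
          push_cast
          rw [← Real.rpow_natCast, ← Real.rpow_natCast, ← Real.rpow_mul (by positivity), ← Real.rpow_mul (by positivity), mul_comm]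
        rw [this, ← ENNReal.ofReal_one, ← ENNReal.ofReal_sub _ (by positivity), ENNReal.ofReal_inv_of_pos (hpos l hl)]
      · intro l hl
        have hl := (Nat.mem_primesBelow.mp hl).2
        exact pow_nonneg (inv_nonneg.mpr (hpos l hl).le) _
    · intro a ha b hb hab
      simp only [Function.onFun]
      rw [Finset.disjoint_left]
      intro q hqa hqb
      apply hab
      simp only [Set.Finite.mem_toFinset] at hqa hqb
      have h1 := hqa.2.over
      have h2 := hqb.2.over
      have := h1.trans h2.symm
      rw [span_singleton_eq_span_singleton, Int.associated_iff_natAbs] at this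
      simpa using this
  simp_rw [hprod] at key
  have hE2 := (ENNReal.continuous_ofReal.tendsto E).comp hE
  have htot : ∑' x : {x : Ideal (𝓞 F) // x ≠ 0}, w x = ENNReal.ofReal E := tendsto_nhds_unique key hE2
  have hE0 : 0 ≤ E := by
    refine ge_of_tendsto hE (Eventually.of_forall fun N => prod_nonneg fun l hl => ?_)
    have hl := (Nat.mem_primesBelow.mp hl).2
    apply pow_nonneg; rw [inv_nonneg, sub_nonneg]
    apply pow_le_one₀ (by positivity)
    exact Real.rpow_le_one_of_one_le_of_nonpos (by exact_mod_cast hl.one_lt.le) (by linarith)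
  -- group by norm
  let c : ℕ → ℝ := fun n => if n = 0 then 0 else (Nat.card {I : Ideal (𝓞 F) // absNorm I = n}) * (n:ℝ)^(-s)
  have hc0 : ∀ n, 0 ≤ c n := fun n => by simp only [c]; split_ifs <;> positivity
  have hgroup : ∑' n, ENNReal.ofReal (c n) = ENNReal.ofReal E := by
    rw [← htot, ← (Equiv.sigmaFiberEquiv (fun x : {x : Ideal (𝓞 F) // x ≠ 0} => absNorm x.1)).tsum_eq, ENNReal.tsum_sigma']
    refine tsum_congr fun n => ?_
    have : ∀ x : {x : {x : Ideal (𝓞 F) // x ≠ 0} // absNorm x.1 = n},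
      w ((Equiv.sigmaFiberEquiv (fun x : {x : Ideal (𝓞 F) // x ≠ 0} => absNorm x.1)) ⟨n, x⟩) = ENNReal.ofReal ((n:ℝ)^(-s)) := by
      intro x
      simp only [Equiv.sigmaFiberEquiv, Equiv.coe_fn_mk, w, x.2]
    simp_rw [this]
    rw [ENNReal.tsum_const]
    simp only [c]
    split_ifs with hn
    · subst hn
      have : IsEmpty {x : {x : Ideal (𝓞 F) // x ≠ 0} // absNorm x.1 = 0} :=
        ⟨fun x => x.1.2 (absNorm_eq_zero_iff.mp x.2)⟩
      rw [(ENat.card_eq_zero_iff_empty _).mpr this]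
      simp
    · have e : {x : {x : Ideal (𝓞 F) // x ≠ 0} // absNorm x.1 = n} ≃ {I : Ideal (𝓞 F) // absNorm I = n} :=
        { toFun := fun x => ⟨x.1.1, x.2⟩
          invFun := fun x => ⟨⟨x.1, fun h => hn (by rw [← x.2, h]; simp)⟩, x.2⟩
          left_inv := fun x => rfl
          right_inv := fun x => rfl }
      have hfn : Finite {I : Ideal (𝓞 F) // absNorm I = n} := Ideal.finite_setOfPred_absNorm_eq n
      rw [ENat.card_congr e, ENat.card_eq_coe_natCard, ENNReal.ofReal_mul (by positivity)]
      simp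
  have hsum : HasSum c E := by
    have h1 : Summable c := by
      have : ∑' n, ENNReal.ofReal (c n) ≠ ⊤ := by rw [hgroup]; exact ENNReal.ofReal_ne_top
      have h2 := ENNReal.summable_toReal this
      simpa [ENNReal.toReal_ofReal (hc0 _)] using h2
    have h3 := ENNReal.ofReal_tsum_of_nonneg hc0 h1
    rw [hgroup, ENNReal.ofReal_eq_ofReal_iff (tsum_nonneg hc0) hE0] at h3
    rw [← h3]; exact h1.hasSum
  have hsumC := Complex.hasSum_ofReal.mpr hsum
  rw [dedekindZeta, LSeries, ← hsumC.tsum_eq]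
  refine tsum_congr fun n => ?_
  simp only [c, LSeries.term_def]
  split_ifs with hn
  · simp
  · push_cast
    rw [Complex.ofReal_cpow (by positivity), div_eq_mul_inv]
    push_cast
    rw [Complex.cpow_neg]
end PartC2

section PartC3
open Ideal NumberField Finset Pointwise

lemma cyc_sub_eq {G : Type*} [CommGroup G] [IsCyclic G] [Finite G] (D : Subgroup G) :
    D = (powMonoidHom (Nat.card D) : G →* G).ker := by
  apply Subgroup.eq_of_le_of_card_ge
  · intro x hx
    rw [MonoidHom.mem_ker, powMonoidHom_apply]
    have := pow_card_eq_one' (x := (⟨x, hx⟩ : D))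
    exact Subtype.ext_iff.mp this
  · rw [IsCyclic.card_powMonoidHom_ker, Nat.gcd_eq_right (Subgroup.card_subgroup_dvd_card D)]

lemma cyc_inf' {G : Type*} [CommGroup G] [IsCyclic G] [Finite G] (D H : Subgroup G) :
    Nat.card (D ⊓ H : Subgroup G) = (Nat.card D).gcd (Nat.card H) := by
  have : D ⊓ H = (powMonoidHom ((Nat.card D).gcd (Nat.card H)) : G →* G).ker := by
    conv_lhs => rw [cyc_sub_eq D, cyc_sub_eq H]
    ext x
    simp only [Subgroup.mem_inf, MonoidHom.mem_ker, powMonoidHom_apply, ← orderOf_dvd_iff_pow_eq_one, Nat.dvd_gcd_iff]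
  rw [this, IsCyclic.card_powMonoidHom_ker, Nat.gcd_eq_right]
  exact (Nat.gcd_dvd_left _ _).trans (Subgroup.card_subgroup_dvd_card D)

lemma cyc_inf {G : Type*} [Group G] [IsCyclic G] [Finite G] (D H : Subgroup G) :
    Nat.card (D ⊓ H : Subgroup G) = (Nat.card D).gcd (Nat.card H) := by
  let _ := IsCyclic.commGroup (α := G)
  exact cyc_inf' D H

lemma cyc_unique {G : Type*} [Group G] [IsCyclic G] [Finite G] (D H : Subgroup G) (h : Nat.card D = Nat.card H) :
    D = H := by
  let _ := IsCyclic.commGroup (α := G)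
  exact (cyc_sub_eq D).trans (h ▸ (cyc_sub_eq H).symm)

section
lemma gal_cyclic (p : ℕ) [Fact p.Prime] (K : Type*) [Field K] [NumberField K] [IsCyclotomicExtension {p} ℚ K] : IsCyclic Gal(K/ℚ) := by
  have e := IsCyclotomicExtension.Rat.galEquivZMod p K
  exact (MulEquiv.isCyclic e).mpr inferInstance

variable (p : ℕ) [Fact p.Prime] (K : Type*) [Field K] [NumberField K] [IsCyclotomicExtension {p} ℚ K]
variable (F : Type*) [Field F] [NumberField F] [Algebra F K]

lemma local_unram (l : ℕ) [hl : Fact l.Prime] (hlp : l ≠ p) (P : Ideal (𝓞 F)) [hP : P.IsPrime] [P.LiesOver (span {(l:ℤ)})] :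
    P.ramificationIdx ℤ = 1 ∧ P.inertiaDeg ℤ = orderOf ((l : ZMod p) ^ Module.finrank F K) := by
  have hnd : ¬ l ∣ p := fun h => hlp ((Nat.prime_dvd_prime_iff_eq hl.out Fact.out).mp h)
  obtain ⟨⟨Q, hQ, hQP⟩⟩ := P.nonempty_primesOver (S := 𝓞 K)
  have hQl : Q.LiesOver (span {(l:ℤ)}) := LiesOver.trans Q P _
  have : IsGalois ℚ K := IsCyclotomicExtension.isGalois {p} ℚ K
  have : IsGalois F K := IsGalois.tower_top_of_isGalois ℚ F K
  have hspan : (span {(l:ℤ)}) ≠ ⊥ := by simpa using hl.out.ne_zero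
  have hPbot : P ≠ ⊥ := Ideal.ne_bot_of_liesOver_of_ne_bot hspan P
  have e1 := IsCyclotomicExtension.Rat.ramificationIdx_eq_of_not_dvd l K Q hnd
  have f1 := IsCyclotomicExtension.Rat.inertiaDeg_eq_of_not_dvd l K Q hnd
  have et := ramificationIdx_tower (R := ℤ) P Q
  have ft := inertiaDeg_tower (R := ℤ) P Q
  rw [e1] at et
  have et2 := Nat.eq_one_of_mul_eq_one_right et.symm
  have et3 := Nat.eq_one_of_mul_eq_one_left et.symm
  refine ⟨et2, ?_⟩
  have : (span {(l:ℤ)}).IsPrime := by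
    rw [span_singleton_prime (by exact_mod_cast hl.out.ne_zero)]; exact Nat.prime_iff_prime_int.mp hl.out
  have c1 := Ideal.card_stabilizer_eq (G := Gal(K/ℚ)) (span {(l:ℤ)}) Q
  rw [ramificationIdxIn_eq_ramificationIdx _ Q Gal(K/ℚ), inertiaDegIn_eq_inertiaDeg _ Q Gal(K/ℚ), e1, f1, one_mul] at c1
  have : P.IsMaximal := hP.isMaximal hPbot
  have : Finite (𝓞 F ⧸ P) := P.finiteQuotientOfFreeOfNeBot hPbot
  have : Finite P.ResidueField := Finite.of_surjective _ (Ideal.bijective_algebraMap_quotient_residueField P).2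
  have c2 := Ideal.card_stabilizer_eq (G := Gal(K/F)) P Q
  rw [ramificationIdxIn_eq_ramificationIdx _ Q Gal(K/F), inertiaDegIn_eq_inertiaDeg _ Q Gal(K/F), et3, one_mul] at c2
  have hcyc := gal_cyclic p K
  let φ : Gal(K/F) →* Gal(K/ℚ) := AlgEquiv.restrictScalarsHom ℚ
  have hφ : Function.Injective φ := AlgEquiv.restrictScalars_injective ℚ
  have c3 : Nat.card (MulAction.stabilizer Gal(K/F) Q) = (orderOf (l : ZMod p)).gcd (Module.finrank F K) := by
    rw [← IsGalois.card_aut_eq_finrank F K, ← c1, show Nat.card Gal(K/F) = Nat.card φ.range from Nat.card_congr (MonoidHom.ofInjective hφ).toEquiv, ← cyc_inf, inf_comm, ← Subgroup.map_comap_eq]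
    rw [Nat.card_congr ((Subgroup.equivMapOfInjective _ φ hφ).toEquiv.symm)]
    rfl
  rw [c2] at c3
  have hd : 0 < orderOf (l : ZMod p) := by
    rw [← c1]; exact Nat.card_pos
  have hk : orderOf (l : ZMod p) = P.inertiaDeg ℤ * (orderOf (l : ZMod p)).gcd (Module.finrank F K) := by
    rw [← c3, ← ft, f1]
  rw [orderOf_pow' _ Module.finrank_pos.ne', eq_comm]
  exact Nat.div_eq_of_eq_mul_left (Nat.gcd_pos_of_pos_left _ hd) hk

lemma unram_norm (l : ℕ) (hl : l.Prime) (hlp : l ≠ p) (P : Ideal (𝓞 F)) (hP : P ∈ primesOver (span {(l:ℤ)}) (𝓞 F)) :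
    absNorm P = l ^ orderOf ((l : ZMod p) ^ Module.finrank F K) := by
  obtain ⟨h1, h2⟩ := hP
  haveI : Fact l.Prime := ⟨hl⟩
  have hspan : (span {(l:ℤ)}) ≠ ⊥ := by simpa using hl.ne_zero
  have hPbot : P ≠ ⊥ := Ideal.ne_bot_of_liesOver_of_ne_bot hspan P
  have : (span {(l:ℤ)}).IsPrime := by
    rw [span_singleton_prime (by exact_mod_cast hl.ne_zero)]; exact Nat.prime_iff_prime_int.mp hl
  have : (span {(l:ℤ)}).IsMaximal := this.isMaximal hspan
  have : P.IsMaximal := h1.isMaximal hPbot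
  rw [absNorm_eq_pow_inertiaDeg' P hl, inertiaDeg'_eq_inertiaDeg, (local_unram p K F l hlp P).2]

lemma unram_count (l : ℕ) (hl : l.Prime) (hlp : l ≠ p) [IsGalois ℚ F] :
    (primesOver (span {(l:ℤ)}) (𝓞 F)).ncard * orderOf ((l : ZMod p) ^ Module.finrank F K) = Module.finrank ℚ F := by
  haveI : Fact l.Prime := ⟨hl⟩
  have hspan : (span {(l:ℤ)}) ≠ ⊥ := by simpa using hl.ne_zero
  have : (span {(l:ℤ)}).IsPrime := by
    rw [span_singleton_prime (by exact_mod_cast hl.ne_zero)]; exact Nat.prime_iff_prime_int.mp hl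
  have : (span {(l:ℤ)}).IsMaximal := this.isMaximal hspan
  obtain ⟨⟨P, hP, hPl⟩⟩ := (span {(l:ℤ)}).nonempty_primesOver (S := 𝓞 F)
  have h := ncard_primesOver_mul_ramificationIdxIn_mul_inertiaDegIn (span {(l:ℤ)}) (𝓞 F) Gal(F/ℚ)
  rw [ramificationIdxIn_eq_ramificationIdx _ P Gal(F/ℚ), inertiaDegIn_eq_inertiaDeg _ P Gal(F/ℚ), (local_unram p K F l hlp P).1, (local_unram p K F l hlp P).2, one_mul, IsGalois.card_aut_eq_finrank] at h
  exact h

end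

lemma ram_norm (p : ℕ) [Fact p.Prime] (K : Type*) [Field K] [NumberField K] [IsCyclotomicExtension {p} ℚ K] (F : Type*) [Field F] [NumberField F] [Algebra F K] (P : Ideal (𝓞 F)) (hP : P ∈ primesOver (span {(p:ℤ)}) (𝓞 F)) :
    absNorm P = p ^ 1 := by
  obtain ⟨h1, h2⟩ := hP
  have hl : p.Prime := Fact.out
  have hspan : (span {(p:ℤ)}) ≠ ⊥ := by simpa using hl.ne_zero
  have hPbot : P ≠ ⊥ := Ideal.ne_bot_of_liesOver_of_ne_bot hspan P
  have : (span {(p:ℤ)}).IsPrime := by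
    rw [span_singleton_prime (by exact_mod_cast hl.ne_zero)]; exact Nat.prime_iff_prime_int.mp hl
  have : (span {(p:ℤ)}).IsMaximal := this.isMaximal hspan
  have : P.IsMaximal := h1.isMaximal hPbot
  rw [absNorm_eq_pow_inertiaDeg' P hl, inertiaDeg'_eq_inertiaDeg]
  obtain ⟨⟨Q, hQ, hQP⟩⟩ := P.nonempty_primesOver (S := 𝓞 K)
  have hQl : Q.LiesOver (span {(p:ℤ)}) := LiesOver.trans Q P _
  have f1 := IsCyclotomicExtension.Rat.inertiaDeg_eq_of_prime p K Q
  have ft := inertiaDeg_tower (R := ℤ) P Q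
  rw [f1] at ft
  rw [Nat.eq_one_of_mul_eq_one_right ft.symm]

lemma ram_count (p : ℕ) [Fact p.Prime] (K : Type*) [Field K] [NumberField K] [IsCyclotomicExtension {p} ℚ K] (F : Type*) [Field F] [NumberField F] [Algebra F K] : (primesOver (span {(p:ℤ)}) (𝓞 F)).ncard = 1 := by
  have h := IsCyclotomicExtension.Rat.ncard_primesOver_of_prime p K
  rw [Set.ncard_eq_one] at h ⊢
  obtain ⟨Q, hQ⟩ := h
  obtain ⟨hQ1, hQ2⟩ : Q ∈ primesOver (span {(p:ℤ)}) (𝓞 K) := by rw [hQ]; rfl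
  refine ⟨Q.under (𝓞 F), Set.eq_singleton_iff_unique_mem.mpr ⟨⟨inferInstance, ?_⟩, ?_⟩⟩
  · exact LiesOver.tower_bot Q _ _
  · rintro P ⟨h1, h2⟩
    obtain ⟨⟨Q', hQ', hQP⟩⟩ := P.nonempty_primesOver (S := 𝓞 K)
    have hQl : Q'.LiesOver (span {(p:ℤ)}) := LiesOver.trans Q' P _
    have : Q' ∈ primesOver (span {(p:ℤ)}) (𝓞 K) := ⟨hQ', hQl⟩
    rw [hQ] at this
    rw [← Set.mem_singleton_iff.mp this]
    exact hQP.over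
end PartC3

section PartC4
open NumberField Filter Topology

lemma zeta_of_factor (p : ℕ) [Fact p.Prime] (K : Type*) [Field K] [NumberField K]
    [IsCyclotomicExtension {p} ℚ K] (F : Type*) [Field F] [NumberField F] [Algebra F K]
    [IsGalois ℚ F] (s : ℝ) (hs : 1 < s) (Φ : ℕ → ℂ) (Ec : ℂ)
    (hΦ : ∀ l : ℕ, l.Prime → l ≠ p → ∀ f g : ℕ, g * f = Module.finrank ℚ F →
      f = orderOf ((l : ZMod p) ^ Module.finrank F K) →
      ((1 - ((l:ℂ)^(-(s:ℂ)))^f)⁻¹)^g = Φ l)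
    (hΦp : (1 - (p:ℂ)^(-(s:ℂ)))⁻¹ = Φ p)
    (hlim : Tendsto (fun N : ℕ => ∏ l ∈ N.primesBelow, Φ l) atTop (𝓝 Ec)) :
    dedekindZeta F s = Ec := by
  classical
  let f : ℕ → ℕ := fun l => if l = p then 1 else orderOf ((l : ZMod p) ^ Module.finrank F K)
  let g : ℕ → ℕ := fun l => (Ideal.primesOver (Ideal.span {(l:ℤ)}) (𝓞 F)).ncard
  let R : ℕ → ℝ := fun N => ∏ l ∈ N.primesBelow, ((1-((l:ℝ)^(-s))^(f l))⁻¹)^(g l)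
  have hR : ∀ N : ℕ, ∏ l ∈ N.primesBelow, Φ l = ((R N : ℝ) : ℂ) := by
    intro N
    simp only [R]
    push_cast
    refine Finset.prod_congr rfl fun l hl => ?_
    have hlp := Nat.prime_of_mem_primesBelow hl
    rw [Complex.ofReal_cpow (by positivity)]
    push_cast
    by_cases h : l = p
    · subst h
      simp only [f, g, if_true, ram_count l K F, pow_one]
      exact hΦp.symm
    · exact (hΦ l hlp h (f l) (g l) (by simp only [f, if_neg h, g]; exact unram_count p K F l hlp h) (by simp only [f, if_neg h])).symm
  simp only [hR] at hlim
  have h1 : Tendsto R atTop (𝓝 Ec.re) := by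
    exact (Complex.continuous_re.tendsto _).comp hlim
  have h2 : Ec = (Ec.re : ℂ) := 
    tendsto_nhds_unique hlim ((Complex.continuous_ofReal.tendsto _).comp h1)
  rw [h2]
  refine zeta_of_local F s hs f g ?_ ?_ (fun _ _ => rfl) _ h1
  · intro l hl P hP
    by_cases h : l = p
    · subst h
      simp only [f, if_true]
      exact ram_norm l K F P hP
    · simp only [f, if_neg h]
      exact unram_norm p K F l hl h P hP
  · intro l hl
    by_cases h : l = p
    · simp [f, h]
    · simp only [f, if_neg h]
      intro h0
      have := unram_count p K F l hl h
      rw [h0, mul_zero] at this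
      exact Module.finrank_pos.ne this

lemma exists_log (p : ℕ) [Fact p.Prime] (v : ℕ) (hv : orderOf (v : ZMod p) = p - 1) (l : ℕ) (hl : l.Prime)
    (hlp : l ≠ p) : ∃ k : ℕ, (l : ZMod p) = v ^ k := by
  have h2 := (Fact.out : p.Prime).two_le
  have hv0 : (v : ZMod p) ≠ 0 := by
    intro h; rw [h, orderOf_zero] at hv; omega
  have hl0 : (l : ZMod p) ≠ 0 := by
    rw [Ne, ZMod.natCast_eq_zero_iff, Nat.prime_dvd_prime_iff_eq Fact.out hl]
    exact fun h => hlp h.symm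
  let u : (ZMod p)ˣ := Units.mk0 _ hv0
  have hu : orderOf u = p - 1 := by rw [← hv, ← orderOf_units]; rfl
  have hT : Subgroup.zpowers u = ⊤ := by
    apply Subgroup.eq_top_of_card_eq
    rw [Nat.card_zpowers, hu, Nat.card_eq_fintype_card, ZMod.card_units]
  have hm : Units.mk0 _ hl0 ∈ Subgroup.zpowers u := by rw [hT]; trivial
  rw [mem_zpowers_iff_mem_range_orderOf] at hm
  simp only [Finset.mem_image] at hm
  obtain ⟨k, _, hk⟩ := hm
  exact ⟨k, by have := congrArg Units.val hk; simpa [u] using this.symm⟩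

lemma order_eq (p : ℕ) (hp : 2 ≤ p) (v : ℕ) (hv : orderOf (v : ZMod p) = p - 1) (m n : ℕ) (hmn : p - 1 = m * n)
    (c : ℂ) (hc : orderOf c = n) (k : ℕ) :
    orderOf (((v : ZMod p) ^ k) ^ m) = orderOf (c ^ k) := by
  rw [orderOf_eq_orderOf_iff]
  intro j
  rw [← pow_mul, ← pow_mul, ← pow_mul, ← orderOf_dvd_iff_pow_eq_one, ← orderOf_dvd_iff_pow_eq_one, hv, hc, hmn,
    mul_left_comm k m j]
  have : m ≠ 0 := by rintro rfl; omega
  exact Nat.mul_dvd_mul_iff_left (Nat.pos_of_ne_zero this)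

lemma ordI : orderOf Complex.I = 4 := by
  rw [orderOf_eq_prime_pow (p := 2) (n := 1)]
  · norm_num
  · norm_num [Complex.ext_iff]
  · norm_num [Complex.I_pow_four]

lemma ord_neg_one : orderOf (-1 : ℂ) = 2 := by
  rw [orderOf_eq_prime (p := 2)] <;> norm_num [Complex.ext_iff]

lemma zeta_four (p : ℕ) [Fact p.Prime] (v : ℕ) (hv : orderOf (v : ZMod p) = p - 1) (K : Type*) [Field K] [NumberField K]
    [IsCyclotomicExtension {p} ℚ K] (F : Type*) [Field F] [NumberField F] [Algebra F K]
    [IsGalois ℚ F] (hF : Module.finrank ℚ F = 4) (χ : DirichletCharacter ℂ p) (hχ : χ (v : ZMod p) = Complex.I) (s : ℝ) (hs : 1 < s) :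
    dedekindZeta F s = riemannZeta s * χ.LFunction s * (χ ^ 2).LFunction s * (χ ^ 3).LFunction s := by
  have hs' : 1 < (s : ℂ).re := by simpa
  have h2 := (Fact.out : p.Prime).two_le
  have hd : p - 1 = Module.finrank F K * 4 := by
    rw [← Nat.totient_prime Fact.out, ← IsCyclotomicExtension.Rat.finrank p K, ← hF, mul_comm, Module.finrank_mul_finrank]
  simp only [DirichletCharacter.LFunction_eq_LSeries _ hs']
  refine zeta_of_factor p K F s hs _ _ ?_ ?_ ((((riemannZeta_eulerProduct hs').mul (χ.LSeries_eulerProduct hs')).mul ((χ^2).LSeries_eulerProduct hs')).mul ((χ^3).LSeries_eulerProduct hs') |>.congr (fun N => by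
    simp only [← Finset.prod_mul_distrib]; rfl))
  · intro l hl hlp f g hfg hf
    obtain ⟨k, hk⟩ := exists_log p v hv l hl hlp
    have hχl : χ (l : ZMod p) = Complex.I ^ k := by rw [hk, map_pow, hχ]
    rw [hk, order_eq p h2 v hv _ 4 hd Complex.I ordI] at hf
    simp only [MulChar.pow_apply' _ (two_ne_zero), MulChar.pow_apply' _ (three_ne_zero), hχl]
    generalize (l:ℂ)^(-(s:ℂ)) = x
    rw [hF] at hfg
    rw [← mul_inv, ← mul_inv, ← mul_inv, inv_pow]
    congr 1
    have hc4 : (Complex.I ^ k) ^ 4 = 1 := by rw [← pow_mul, mul_comm, pow_mul, Complex.I_pow_four, one_pow]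
    generalize Complex.I ^ k = c at hf hc4
    by_cases h1 : c = 1
    · subst h1
      rw [orderOf_one] at hf
      subst hf
      obtain rfl : g = 4 := by omega
      ring
    by_cases h2 : c ^ 2 = 1
    · have : orderOf c = 2 := orderOf_eq_prime h2 h1
      rw [this] at hf
      subst hf
      obtain rfl : g = 2 := by omega
      have : c = -1 := by
        rcases mul_eq_zero.mp (show (c-1)*(c+1) = 0 by linear_combination h2) with h | h
        · exact absurd (sub_eq_zero.mp h) h1
        · linear_combination h
      subst this
      ring
    · have : orderOf c = 4 := by
        rw [orderOf_eq_prime_pow (p := 2) (n := 1)]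
        · norm_num
        · simpa using h2
        · simpa using hc4
      rw [this] at hf
      subst hf
      obtain rfl : g = 1 := by omega
      have : c ^ 2 = -1 := by
        have : (c^2 - 1) * (c^2 + 1) = 0 := by linear_combination hc4
        rcases mul_eq_zero.mp this with h | h
        · exact absurd (sub_eq_zero.mp h) h2
        · linear_combination h
      rw [show c^3 = -c by rw [pow_succ, this]; ring, this]
      linear_combination (x^2 - x^4) * this
  · have : ((p : ℕ) : ZMod p) = 0 := by simp
    have h0 : ∀ ψ : DirichletCharacter ℂ p, ψ ((p : ℕ) : ZMod p) = 0 := by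
      intro ψ; rw [this]; exact ψ.map_zero
    simp only [h0, zero_mul, sub_zero, inv_one, mul_one]

lemma zeta_two (p : ℕ) [Fact p.Prime] (v : ℕ) (hv : orderOf (v : ZMod p) = p - 1) (K : Type*) [Field K] [NumberField K]
    [IsCyclotomicExtension {p} ℚ K] (F : Type*) [Field F] [NumberField F] [Algebra F K]
    [IsGalois ℚ F] (hF : Module.finrank ℚ F = 2) (χ : DirichletCharacter ℂ p) (hχ : χ (v : ZMod p) = -1) (s : ℝ) (hs : 1 < s) :
    dedekindZeta F s = riemannZeta s * χ.LFunction s := by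
  have hs' : 1 < (s : ℂ).re := by simpa
  have h2 := (Fact.out : p.Prime).two_le
  have hd : p - 1 = Module.finrank F K * 2 := by
    rw [← Nat.totient_prime Fact.out, ← IsCyclotomicExtension.Rat.finrank p K, ← hF, mul_comm, Module.finrank_mul_finrank]
  simp only [DirichletCharacter.LFunction_eq_LSeries _ hs']
  refine zeta_of_factor p K F s hs _ _ ?_ ?_ (((riemannZeta_eulerProduct hs').mul (χ.LSeries_eulerProduct hs')) |>.congr (fun N => by
    simp only [← Finset.prod_mul_distrib]; rfl))
  · intro l hl hlp f g hfg hf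
    obtain ⟨k, hk⟩ := exists_log p v hv l hl hlp
    have hχl : χ (l : ZMod p) = (-1) ^ k := by rw [hk, map_pow, hχ]
    rw [hk, order_eq p h2 v hv _ 2 hd (-1) ord_neg_one] at hf
    simp only [hχl]
    generalize (l:ℂ)^(-(s:ℂ)) = x
    rw [hF] at hfg
    rw [← mul_inv, inv_pow]
    congr 1
    rcases neg_one_pow_eq_or ℂ k with h | h
    · rw [h, orderOf_one] at hf
      rw [h]
      subst hf
      obtain rfl : g = 2 := by omega
      ring
    · rw [h, ord_neg_one] at hf
      rw [h]
      subst hf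
      obtain rfl : g = 1 := by omega
      ring
  · have : ((p : ℕ) : ZMod p) = 0 := by simp
    have h0 : ∀ ψ : DirichletCharacter ℂ p, ψ ((p : ℕ) : ZMod p) = 0 := by
      intro ψ; rw [this]; exact ψ.map_zero
    simp only [h0, zero_mul, sub_zero, inv_one, mul_one]
end PartC4

section PartD1
open NumberField Filter Topology

lemma tendsto_zeta_real : Tendsto (fun s : ℝ => ((s:ℂ) - 1) * riemannZeta s) (𝓝[>] 1) (𝓝 1) := by
  refine riemannZeta_residue_one.comp ?_
  refine tendsto_nhdsWithin_iff.mpr ⟨?_, ?_⟩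
  · have : Tendsto (fun s : ℝ => (s : ℂ)) (𝓝 1) (𝓝 ((1:ℝ):ℂ)) := Complex.continuous_ofReal.tendsto _
    exact (by simpa using this : Tendsto (fun s : ℝ => (s : ℂ)) (𝓝 1) (𝓝 (1:ℂ))).mono_left nhdsWithin_le_nhds
  · filter_upwards [self_mem_nhdsWithin] with s hs
    have : (1:ℝ) < s := hs
    simp only [Set.mem_compl_iff, Set.mem_singleton_iff]
    exact_mod_cast this.ne'

lemma tendsto_L_real (p : ℕ) [NeZero p] (χ : DirichletCharacter ℂ p) (h : χ ≠ 1) :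
    Tendsto (fun s : ℝ => χ.LFunction s) (𝓝[>] 1) (𝓝 (χ.LFunction 1)) := by
  have h1 : Continuous (fun s : ℝ => χ.LFunction s) :=
    (DirichletCharacter.differentiable_LFunction h).continuous.comp Complex.continuous_ofReal
  have := h1.tendsto 1
  simp only [Complex.ofReal_one] at this
  exact this.mono_left nhdsWithin_le_nhds

lemma char_ne_one (p : ℕ) [Fact p.Prime] (v : ℕ) (hv : orderOf (v : ZMod p) = p - 1) (χ : DirichletCharacter ℂ p)
    (h : χ (v : ZMod p) ≠ 1) : χ ≠ 1 := by
  rintro rfl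
  have h2 := (Fact.out : p.Prime).two_le
  have hv0 : (v : ZMod p) ≠ 0 := by
    intro h; rw [h, orderOf_zero] at hv; omega
  exact h (MulChar.one_apply (isUnit_iff_ne_zero.mpr hv0))

lemma res_four (p : ℕ) [Fact p.Prime] (v : ℕ) (hv : orderOf (v : ZMod p) = p - 1) (K : Type*) [Field K] [NumberField K]
    [IsCyclotomicExtension {p} ℚ K] (F : Type*) [Field F] [NumberField F] [Algebra F K]
    [IsGalois ℚ F] (hF : Module.finrank ℚ F = 4) (χ : DirichletCharacter ℂ p) (hχ : χ (v : ZMod p) = Complex.I) :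
    (dedekindZeta_residue F : ℂ) = χ.LFunction 1 * (χ ^ 2).LFunction 1 * (χ ^ 3).LFunction 1 := by
  have n1 : χ ≠ 1 := char_ne_one p v hv χ (by rw [hχ]; norm_num [Complex.ext_iff])
  have n2 : χ ^ 2 ≠ 1 := char_ne_one p v hv _ (by rw [MulChar.pow_apply' _ two_ne_zero, hχ]; norm_num [Complex.ext_iff])
  have n3 : χ ^ 3 ≠ 1 := char_ne_one p v hv _ (by rw [MulChar.pow_apply' _ three_ne_zero, hχ, Complex.I_pow_three]; norm_num [Complex.ext_iff])
  have h := ((tendsto_zeta_real.mul (tendsto_L_real p χ n1)).mul (tendsto_L_real p _ n2)).mul (tendsto_L_real p _ n3)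
  rw [one_mul] at h
  refine tendsto_nhds_unique ((tendsto_sub_one_mul_dedekindZeta_nhdsGT F).congr' ?_) h
  filter_upwards [self_mem_nhdsWithin] with s hs
  rw [zeta_four p v hv K F hF χ hχ s hs]
  ring

lemma res_two (p : ℕ) [Fact p.Prime] (v : ℕ) (hv : orderOf (v : ZMod p) = p - 1) (K : Type*) [Field K] [NumberField K]
    [IsCyclotomicExtension {p} ℚ K] (F : Type*) [Field F] [NumberField F] [Algebra F K]
    [IsGalois ℚ F] (hF : Module.finrank ℚ F = 2) (χ : DirichletCharacter ℂ p) (hχ : χ (v : ZMod p) = -1) :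
    (dedekindZeta_residue F : ℂ) = χ.LFunction 1 := by
  have n1 : χ ≠ 1 := char_ne_one p v hv χ (by rw [hχ]; norm_num [Complex.ext_iff])
  have h := tendsto_zeta_real.mul (tendsto_L_real p χ n1)
  rw [one_mul] at h
  refine tendsto_nhds_unique ((tendsto_sub_one_mul_dedekindZeta_nhdsGT F).congr' ?_) h
  filter_upwards [self_mem_nhdsWithin] with s hs
  rw [zeta_two p v hv K F hF χ hχ s hs]
  ring

lemma res_ratio (p : ℕ) [Fact p.Prime] (v : ℕ) (hv : orderOf (v : ZMod p) = p - 1) (hp8 : p % 8 = 5)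
    (vn : ℤ → ℕ) (hvn1 : ∀ n, 1 ≤ vn n) (hvn2 : ∀ n, vn n ≤ p - 1)
    (hvn : ∀ n : ℕ, (vn (n : ℤ) : ZMod p) = (v : ZMod p) ^ n)
    (K : Type*) [Field K] [NumberField K]
    [IsCyclotomicExtension {p} ℚ K] (F N : Type*) [Field F] [NumberField F] [Algebra F K]
    [IsGalois ℚ F] (hF : Module.finrank ℚ F = 4) [Field N] [NumberField N] [Algebra N K]
    [IsGalois ℚ N] (hN : Module.finrank ℚ N = 2) :
    dedekindZeta_residue F = dedekindZeta_residue N * (Real.pi ^ 2 / p ^ 3 *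
      (((∑ i ∈ Finset.range ((p - 1) / 2), (-1 : ℤ) ^ i * (vn ((2 * i : ℕ) : ℤ) : ℤ)) ^ 2 +
       (∑ i ∈ Finset.range ((p - 1) / 2), (-1 : ℤ) ^ i * (vn ((2 * i + 1 : ℕ) : ℤ) : ℤ)) ^ 2 : ℤ) : ℝ)) := by
  obtain ⟨χ, hχ, hodd⟩ := exists_char p v hv hp8
  have hinv : χ⁻¹ (v : ZMod p) = - Complex.I := by
    rw [MulChar.inv_apply_eq_inv', hχ, Complex.inv_I]
  have s1 := sum_zmod_eq p v hv vn hvn1 hvn2 hvn χ _ hχ hp8 (by simp)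
  have s2 := sum_zmod_eq p v hv vn hvn1 hvn2 hvn χ⁻¹ _ hinv hp8 (by simp)
  have hL := L_mul_L p χ hodd
  rw [s1, s2] at hL
  have h3 : χ ^ 3 = χ⁻¹ := by
    rw [eq_inv_iff_mul_eq_one, ← pow_succ]
    ext a
    rw [MulChar.pow_apply_coe, MulChar.one_apply_coe]
    have hu : IsUnit (a : ZMod p) := a.isUnit
    have h2 := (Fact.out : p.Prime).two_le
    have hv0 : (v : ZMod p) ≠ 0 := by
      intro h; rw [h, orderOf_zero] at hv; omega
    let u : (ZMod p)ˣ := Units.mk0 _ hv0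
    have hu : orderOf u = p - 1 := by rw [← hv, ← orderOf_units]; rfl
    have hT : Subgroup.zpowers u = ⊤ := by
      apply Subgroup.eq_top_of_card_eq
      rw [Nat.card_zpowers, hu, Nat.card_eq_fintype_card, ZMod.card_units]
    have hm : a ∈ Subgroup.zpowers u := by rw [hT]; trivial
    rw [mem_zpowers_iff_mem_range_orderOf] at hm
    simp only [Finset.mem_image] at hm
    obtain ⟨k, _, rfl⟩ := hm
    rw [Units.val_pow_eq_pow_val, map_pow, show ((u : (ZMod p)ˣ) : ZMod p) = v from rfl, hχ, ← pow_mul, mul_comm, pow_mul]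
    simp
  have r4 := res_four p v hv K F hF χ hχ
  have r2 := res_two p v hv K N hN (χ ^ 2) (by rw [MulChar.pow_apply' _ two_ne_zero, hχ]; simp)
  rw [← r2, h3, mul_right_comm, hL] at r4
  apply Complex.ofReal_injective
  rw [r4]
  push_cast
  ring_nf
  simp only [Complex.I_sq]
  ring
end PartD1

section PartD2
open NumberField Module

lemma exists_prim_torsion (F : Type*) [Field F] [NumberField F] :
    ∃ ζ : F, IsPrimitiveRoot ζ (Units.torsionOrder F) := by
  obtain ⟨g, hg⟩ := IsCyclic.exists_ofOrder_eq_natCard (α := Units.torsion F)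
  have h1 : orderOf (((g : (𝓞 F)ˣ) : 𝓞 F) : F) = Units.torsionOrder F := by
    rw [Units.torsionOrder, ← hg, ← Subgroup.orderOf_coe g, ← orderOf_units]
    exact orderOf_injective (algebraMap (𝓞 F) F : 𝓞 F →* F) RingOfIntegers.coe_injective _
  exact ⟨_, h1 ▸ IsPrimitiveRoot.orderOf _⟩

lemma tors_real (F : Type*) [Field F] [NumberField F] (h : InfinitePlace.nrRealPlaces F ≠ 0) :
    Units.torsionOrder F = 2 := by
  obtain ⟨ζ, hζ⟩ := exists_prim_torsion F
  have h1 := Units.even_torsionOrder F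
  have h2 := Units.torsionOrder_pos F
  by_contra h3
  have : 2 < Units.torsionOrder F := by
    obtain ⟨k, hk⟩ := h1; omega
  exact h (InfinitePlace.IsPrimitiveRoot.nrRealPlaces_eq_zero_of_two_lt this hζ)

lemma tors_dvd (F K : Type*) [Field F] [NumberField F] [Field K] [NumberField K] [Algebra F K] :
    Units.torsionOrder F ∣ Units.torsionOrder K := by
  obtain ⟨ζ, hζ⟩ := exists_prim_torsion F
  have : NeZero (Units.torsionOrder F) := ⟨Units.torsionOrder_ne_zero F⟩
  exact Units.dvd_torsionOrder_of_isPrimitiveRoot (hζ.map_of_injective (algebraMap F K).injective)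

lemma real_or_complex (F : Type*) [Field F] [NumberField F] [IsGalois ℚ F] : IsTotallyReal F ∨ IsTotallyComplex F := by
  by_cases h : ∃ w : InfinitePlace F, w.IsReal
  · left
    obtain ⟨w, hw⟩ := h
    refine ⟨fun w' => ?_⟩
    obtain ⟨σ, rfl⟩ := InfinitePlace.exists_smul_eq_of_comap_eq (k := ℚ) (w := w) (w' := w') (Subsingleton.elim _ _)
    exact InfinitePlace.isReal_smul_iff.mpr hw
  · right
    refine ⟨fun w => ?_⟩
    rw [← InfinitePlace.not_isReal_iff_isComplex]
    exact fun hw => h ⟨w, hw⟩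

lemma L_complex (p : ℕ) [Fact p.Prime] (hp8 : p % 8 = 5) (K : Type*) [Field K] [NumberField K]
    [IsCyclotomicExtension {p} ℚ K] (L : IntermediateField ℚ K) (hL : finrank ℚ L = 4) : IsTotallyComplex L := by
  have : IsAbelianGalois ℚ K := IsCyclotomicExtension.isAbelianGalois {p} ℚ K
  have : IsAbelianGalois ℚ L := IsAbelianGalois.tower_bot ℚ L K
  have : IsGalois ℚ L := this.toIsGalois
  refine (real_or_complex L).resolve_left fun hr => ?_
  have hr' : IsTotallyReal L.toSubfield := hr
  have : IsCMField K := IsCyclotomicExtension.Rat.isCMField K (S := {p}) ⟨p, rfl, by omega⟩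
  have h1 := Subfield.relfinrank_mul_finrank_top (IsTotallyReal.le_maximalRealSubfield L.toSubfield)
  rw [Algebra.IsQuadraticExtension.finrank_eq_two] at h1
  have h2 := Module.finrank_mul_finrank ℚ L K
  rw [hL, IsCyclotomicExtension.Rat.finrank p K, Nat.totient_prime Fact.out] at h2
  have h3 : finrank L.toSubfield K = finrank L K := rfl
  omega

lemma sub_unique (p : ℕ) [Fact p.Prime] (K : Type*) [Field K] [NumberField K]
    [IsCyclotomicExtension {p} ℚ K] (E M : IntermediateField ℚ K) (h : finrank ℚ E = finrank ℚ M) : E = M := by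
  have : IsGalois ℚ K := IsCyclotomicExtension.isGalois {p} ℚ K
  have := gal_cyclic p K
  have hE := Module.finrank_mul_finrank ℚ E K
  have hM := Module.finrank_mul_finrank ℚ M K
  have h0 : 0 < finrank ℚ M := finrank_pos
  have : finrank E K = finrank M K := by
    rw [← hM, h] at hE
    exact Nat.eq_of_mul_eq_mul_left h0 hE
  rw [← IsGalois.card_fixingSubgroup_eq_finrank, ← IsGalois.card_fixingSubgroup_eq_finrank] at this
  have := cyc_unique _ _ this
  rw [← IsGalois.fixedField_fixingSubgroup E, this, IsGalois.fixedField_fixingSubgroup M]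

lemma class_eq (p : ℕ) [Fact p.Prime] (K : Type*) [Field K] [NumberField K]
    [IsCyclotomicExtension {p} ℚ K] (M : IntermediateField ℚ K) (N : Type*) [Field N] [NumberField N] [Algebra N K]
    (h : finrank ℚ N = finrank ℚ M) : classNumber N = classNumber M := by
  let φ : N →ₐ[ℚ] K := IsScalarTower.toAlgHom ℚ N K
  let e : N ≃ₐ[ℚ] φ.fieldRange := AlgEquiv.ofInjectiveField φ
  have : φ.fieldRange = M := sub_unique p K _ _ (by rw [← h]; exact e.toLinearEquiv.finrank_eq.symm)
  rw [← this]
  unfold classNumber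
  rw [← Nat.card_eq_fintype_card, ← Nat.card_eq_fintype_card]
  exact Nat.card_congr (ClassGroup.mulEquiv (RingOfIntegers.mapRingEquiv e.toRingEquiv)).toEquiv
end PartD2

open NumberField Finset

lemma class_formula (F : Type*) [Field F] [NumberField F] [IsCMField F] (hF : Module.finrank ℚ F = 4) (p : ℕ) (hp : 0 < p) (S : ℤ)
    (hres : dedekindZeta_residue F = dedekindZeta_residue (maximalRealSubfield F) * (Real.pi ^ 2 / p ^ 3 * (S : ℝ))) :
    16 * (p : ℤ) ^ 6 * (classNumber F : ℤ) ^ 2 * |discr (maximalRealSubfield F)| =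
      (IsCMField.indexRealUnits F : ℤ) ^ 2 * (Units.torsionOrder F : ℤ) ^ 2 * (classNumber (maximalRealSubfield F) : ℤ) ^ 2 * S ^ 2 * |discr F| := by
  have hq := IsCMField.regulator_div_regulator_eq_two_pow_mul_indexRealUnits_inv F
  set N := maximalRealSubfield F with hNdef
  have hN : Module.finrank ℚ N = 2 := by
    have h1 := Module.finrank_mul_finrank ℚ N F
    have h2 : Module.finrank N F = 2 := Algebra.IsQuadraticExtension.finrank_eq_two N F
    rw [h2, hF] at h1
    omega
  have hr0 : InfinitePlace.nrRealPlaces F = 0 := IsTotallyComplex.nrRealPlaces_eq_zero F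
  have hc0 : InfinitePlace.nrComplexPlaces N = 0 := IsTotallyReal.nrComplexPlaces_eq_zero N
  have hc2 : InfinitePlace.nrComplexPlaces F = 2 := by
    have := InfinitePlace.card_add_two_mul_card_eq_rank F
    omega
  have hr2 : InfinitePlace.nrRealPlaces N = 2 := by
    have := InfinitePlace.card_add_two_mul_card_eq_rank N
    omega
  have hrank : Units.rank F = 1 := by
    rw [Units.rank, InfinitePlace.card_eq_nrRealPlaces_add_nrComplexPlaces]
    omega
  have htN : Units.torsionOrder N = 2 := tors_real N (by omega)
  rw [dedekindZeta_residue_def, dedekindZeta_residue_def, hr0, hc0, hc2, hr2, htN] at hres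
  rw [hrank] at hq
  have hRN : 0 < Units.regulator N := Units.regulator_pos N
  have hQ : (0:ℝ) < IsCMField.indexRealUnits F := by
    rcases IsCMField.indexRealUnits_eq_one_or_two F with h | h <;> rw [h] <;> norm_num
  have hw : (0:ℝ) < Units.torsionOrder F := by exact_mod_cast Units.torsionOrder_pos F
  have hDF : (0:ℝ) < |(discr F : ℝ)| := by
    rw [abs_pos]; exact_mod_cast discr_ne_zero F
  have hDN : (0:ℝ) < |(discr N : ℝ)| := by
    rw [abs_pos]; exact_mod_cast discr_ne_zero N
  have hp' : (0:ℝ) < p := by exact_mod_cast hp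
  have hpi := Real.pi_pos
  rw [div_eq_iff hRN.ne'] at hq
  rw [hq] at hres
  have e1 : 4 * (p:ℝ)^3 * classNumber F * √|(discr N : ℝ)| =
      IsCMField.indexRealUnits F * Units.torsionOrder F * classNumber N * S * √|(discr F : ℝ)| := by
    have s1 := Real.sqrt_pos.mpr hDF
    have s2 := Real.sqrt_pos.mpr hDN
    generalize √|(discr F : ℝ)| = a at *
    generalize √|(discr N : ℝ)| = b at *
    generalize Units.regulator N = R at *
    generalize (classNumber F : ℝ) = x at *
    generalize (classNumber N : ℝ) = y at *
    generalize (IsCMField.indexRealUnits F : ℝ) = Q at *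
    generalize (Units.torsionOrder F : ℝ) = w at *
    field_simp at hres
    push_cast at hres
    linear_combination hres
  have e2 := congrArg (fun t => t ^ 2) e1
  simp only [mul_pow, Real.sq_sqrt hDF.le, Real.sq_sqrt hDN.le] at e2
  have e3 : ((16 * (p : ℤ) ^ 6 * (classNumber F : ℤ) ^ 2 * |discr N| : ℤ) : ℝ) =
      (((IsCMField.indexRealUnits F : ℤ) ^ 2 * (Units.torsionOrder F : ℤ) ^ 2 * (classNumber N : ℤ) ^ 2 * S ^ 2 * |discr F| : ℤ) : ℝ) := by
    push_cast
    linear_combination e2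
  exact_mod_cast e3

theorem statement18
    (p : ℕ) (hp : p.Prime) (hp2 : p ≠ 2)
    (v : ℕ) (hv1 : 1 ≤ v) (hv2 : v ≤ p - 1)
    (hv : orderOf (v : ZMod p) = p - 1)
    (vn : ℤ → ℕ)
    (hvn1 : ∀ n : ℤ, 1 ≤ vn n) (hvn2 : ∀ n : ℤ, vn n ≤ p - 1)
    (hvn0 : vn 0 = 1)
    (hvnrec : ∀ n : ℤ, (vn (n + 1) : ZMod p) = (v : ZMod p) * (vn n : ZMod p))
    (hp8 : p % 8 = 5)
    (K : Type*) [Field K] [NumberField K]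
    [IsCyclotomicExtension {p} ℚ K]
    (ζ : K) (hζ : IsPrimitiveRoot ζ p)
    (σ : K ≃ₐ[ℚ] K) (hσ : σ ζ = ζ ^ v)
    (L M : IntermediateField ℚ K)
    (hL : Module.finrank ℚ L = 4) (hM : Module.finrank ℚ M = 2)
    (hML : M ≤ L)
    (h : ℕ) (hh : h.Prime) (hhodd : h ≠ 2)
    (hdvdL : h ∣ NumberField.classNumber L)
    (hndvdM : ¬ h ∣ NumberField.classNumber M) :
    ((∑ i ∈ Finset.range ((p - 1) / 2), (-1 : ℤ) ^ i * (vn ((2 * i : ℕ) : ℤ) : ℤ)) ^ 2 +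
     (∑ i ∈ Finset.range ((p - 1) / 2), (-1 : ℤ) ^ i * (vn ((2 * i + 1 : ℕ) : ℤ) : ℤ)) ^ 2 ≠ 0)
    ∧
    (h : ℤ) ∣
      ((∑ i ∈ Finset.range ((p - 1) / 2), (-1 : ℤ) ^ i * (vn ((2 * i : ℕ) : ℤ) : ℤ)) ^ 2 +
       (∑ i ∈ Finset.range ((p - 1) / 2), (-1 : ℤ) ^ i * (vn ((2 * i + 1 : ℕ) : ℤ) : ℤ)) ^ 2) := by
  have hvn : ∀ n : ℕ, (vn (n : ℤ) : ZMod p) = (v : ZMod p) ^ n := vn_cast p v vn hvn0 hvnrec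
  have : Fact p.Prime := ⟨hp⟩
  constructor
  · have hodd := partA_odd p hp v hv vn hvn1 hvn2 hvn hp8
    intro h0
    have hA : (∑ i ∈ Finset.range ((p - 1) / 2), (-1 : ℤ) ^ i * (vn ((2 * i : ℕ) : ℤ) : ℤ)) = 0 := by nlinarith
    rw [hA] at hodd
    exact absurd hodd (by decide)
  by_cases hhp : h = p
  · rw [hhp]; exact partA_p p hp v hv vn hvn hp8
  have : IsAbelianGalois ℚ K := IsCyclotomicExtension.isAbelianGalois {p} ℚ K
  have : IsAbelianGalois ℚ L := IsAbelianGalois.tower_bot ℚ L K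
  have : IsGalois ℚ L := this.toIsGalois
  have : IsTotallyComplex L := L_complex p hp8 K L hL
  have : IsCMField L := IsCMField.of_isAbelianGalois L
  let N := maximalRealSubfield L
  have hN : Module.finrank ℚ N = 2 := by
    have h1 := Module.finrank_mul_finrank ℚ N L
    have h2 : Module.finrank N L = 2 := Algebra.IsQuadraticExtension.finrank_eq_two N L
    rw [h2, hL] at h1
    omega
  let _ : Algebra N K := ((algebraMap L K).comp (algebraMap N L)).toAlgebra
  have : Algebra.IsQuadraticExtension ℚ N := ⟨hN⟩
  have : IsGalois ℚ N := inferInstance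
  have hres := res_ratio p v hv hp8 vn hvn1 hvn2 hvn K L N hL hN
  have hcl : classNumber N = classNumber M := class_eq p K M N (by rw [hN, hM])
  have hf := class_formula L hL p hp.pos _ hres
  rw [show classNumber (maximalRealSubfield L) = classNumber M from hcl] at hf
  generalize ((∑ i ∈ Finset.range ((p - 1) / 2), (-1 : ℤ) ^ i * (vn ((2 * i : ℕ) : ℤ) : ℤ)) ^ 2 +
       (∑ i ∈ Finset.range ((p - 1) / 2), (-1 : ℤ) ^ i * (vn ((2 * i + 1 : ℕ) : ℤ) : ℤ)) ^ 2) = S at *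
  have hhZ : Prime (h : ℤ) := Nat.prime_iff_prime_int.mp hh
  have hdvd : (h : ℤ) ∣ 16 * (p : ℤ) ^ 6 * (classNumber L : ℤ) ^ 2 * |discr (maximalRealSubfield L)| :=
    Dvd.dvd.mul_right (Dvd.dvd.mul_left (dvd_pow (by exact_mod_cast hdvdL) two_ne_zero) _) _
  rw [hf] at hdvd
  have hnp : ¬ h ∣ p := fun hd => hhp ((Nat.prime_dvd_prime_iff_eq hh hp).mp hd)
  have hn2 : ¬ h ∣ 2 := fun hd => hhodd ((Nat.prime_dvd_prime_iff_eq hh Nat.prime_two).mp hd)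
  rcases hhZ.dvd_or_dvd hdvd with hd | hd
  · rcases hhZ.dvd_or_dvd hd with hd | hd
    · exfalso
      rcases hhZ.dvd_or_dvd hd with hd | hd
      · rcases hhZ.dvd_or_dvd hd with hd | hd
        · have hd := Int.natCast_dvd_natCast.mp (hhZ.dvd_of_dvd_pow hd)
          rcases IsCMField.indexRealUnits_eq_one_or_two L with hq | hq <;> rw [hq] at hd
          · exact hh.one_lt.ne' (Nat.dvd_one.mp hd)
          · exact hn2 hd
        · have hd := Int.natCast_dvd_natCast.mp (hhZ.dvd_of_dvd_pow hd)
          have hd := hd.trans (tors_dvd L K)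
          rw [IsCyclotomicExtension.Rat.torsionOrder_eq (n := p) (K := K), if_neg (by rw [Nat.even_iff]; omega)] at hd
          rcases hh.dvd_mul.mp hd with hd | hd
          · exact hn2 hd
          · exact hnp hd
      · exact hndvdM (Int.natCast_dvd_natCast.mp (hhZ.dvd_of_dvd_pow hd))
    · exact hhZ.dvd_of_dvd_pow hd
  · exfalso
    rw [dvd_abs] at hd
    have hd := hd.trans (discr_dvd_discr L K)
    rw [IsCyclotomicExtension.Rat.discr_prime p K] at hd
    rcases hhZ.dvd_or_dvd hd with hd | hd
    · have := hhZ.dvd_of_dvd_pow hd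
      rw [Int.dvd_neg] at this
      exact hhZ.not_dvd_one this
    · exact hnp (Int.natCast_dvd_natCast.mp (hhZ.dvd_of_dvd_pow hd))
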